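/- Let (X_n) be a non-regular sequence of compact length surfaces, each with b > 0 boundary components and reduced connectivity number c. Then, after passing to a subsequence, one of the following holds: (1) there is a sequence (gamma_n) where gamma_n is a non-separating simple arc in X_n and diam(gamma_n) → 0; (2) there is a sequence (gamma_n) where gamma_n is a separating simple arc in X_n which does not form a contractible Jordan curve together with a subarc of some boundary component, and diam(gamma_n) → 0; (3) there is a sequence (gamma_n) where gamma_n is a non-contractible simple Jordan curve in X_n and diam(gamma_n) → 0. -/

import Mathlib

open Filter Topology Metric Set GromovHausdorff
open scoped ENNReal unitInterval

noncomputable section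

/-! ## Model spaces -/

/-- The closed upper half plane in `ℝ × ℝ` (used for topological charts). -/
def HalfPlane : Set (ℝ × ℝ) := {p | 0 ≤ p.2}

/-- The closed upper half plane in the Euclidean plane (used for metric charts). -/
def EHalfPlane : Set (EuclideanSpace ℝ (Fin 2)) := {p | 0 ≤ p 1}

/-- The unit circle (the 1-sphere). -/
def Circle1 : Set (EuclideanSpace ℝ (Fin 2)) := Metric.sphere 0 1

/-- The 2-sphere. -/
def Sphere2 : Set (EuclideanSpace ℝ (Fin 3)) := Metric.sphere 0 1

/-- The closed 2-disc. -/
def Disc2 : Set (EuclideanSpace ℝ (Fin 2)) := Metric.closedBall 0 1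

/-- The relation on the unit square generating the Möbius identification
`(0, y) ∼ (1, 1 - y)`. -/
def mobiusRel (p q : I × I) : Prop :=
  ((p.1 : ℝ) = 0 ∧ (q.1 : ℝ) = 1 ∧ (p.2 : ℝ) = 1 - (q.2 : ℝ)) ∨
  ((p.1 : ℝ) = 1 ∧ (q.1 : ℝ) = 0 ∧ (p.2 : ℝ) = 1 - (q.2 : ℝ))

/-- The Möbius band, as a quotient of the unit square. -/
def MobiusBand : Type := Quot mobiusRel

instance : TopologicalSpace MobiusBand :=
  inferInstanceAs (TopologicalSpace (Quot mobiusRel))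

/-! ## Surfaces -/

/-- A topological 2-manifold with (possibly empty) boundary: every point has an open
neighborhood homeomorphic to an open subset of the closed half plane. -/
def IsSurface (X : Type*) [TopologicalSpace X] : Prop :=
  ∀ x : X, ∃ (U : Set X) (V : Set HalfPlane),
    IsOpen U ∧ x ∈ U ∧ IsOpen V ∧ Nonempty (↥U ≃ₜ ↥V)

/-- A compact surface: a compact connected (Hausdorff) topological 2-manifold with
possibly empty boundary. -/
def IsCompactSurface (X : Type*) [TopologicalSpace X] : Prop :=
  CompactSpace X ∧ ConnectedSpace X ∧ T2Space X ∧ IsSurface X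

/-- The (manifold) boundary of a surface: the set of points having no open neighborhood
homeomorphic to an open subset of the plane. -/
def surfaceBoundary (X : Type*) [TopologicalSpace X] : Set X :=
  {x | ¬ ∃ (U : Set X) (V : Set (ℝ × ℝ)), IsOpen U ∧ x ∈ U ∧ IsOpen V ∧ Nonempty (↥U ≃ₜ ↥V)}

/-- The set of boundary components of a surface, i.e. the connected components of the
boundary. -/
def surfaceBoundaryComponents (X : Type*) [TopologicalSpace X] : Set (Set X) :=
  {b | ∃ x ∈ surfaceBoundary X, b = connectedComponentIn (surfaceBoundary X) x}

/-- A surface is orientable iff it contains no subset homeomorphic to the Möbius band. -/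
def SurfOrientable (X : Type*) [TopologicalSpace X] : Prop :=
  ¬ ∃ A : Set X, Nonempty (↥A ≃ₜ MobiusBand)

/-- The free rank of the first homology (the abelianized fundamental group). -/
noncomputable def h1Rank (X : Type*) [TopologicalSpace X] : ℕ :=
  ⨆ x : X, (Module.rank ℤ (Additive (Abelianization (FundamentalGroup X x)))).toNat

open Classical in
/-- The connectivity number of a compact surface `S`, i.e. `2 - χ(S)`.  By the
classification of compact surfaces this equals the free rank of the first homology,
plus one unless the surface is closed and orientable. -/
noncomputable def connNum (X : Type*) [TopologicalSpace X] : ℕ :=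
  h1Rank X + (if surfaceBoundary X = ∅ ∧ SurfOrientable X then 0 else 1)

/-- The reduced connectivity number: the connectivity number minus the number of
boundary components. -/
noncomputable def redConnNum (X : Type*) [TopologicalSpace X] : ℤ :=
  (connNum X : ℤ) - ((surfaceBoundaryComponents X).ncard : ℤ)

/-! ## Length and geodesic spaces -/

/-- The length of a path, as the total variation of the parametrization. -/
noncomputable def pathLength {X : Type*} [MetricSpace X] {x y : X} (γ : Path x y) : ℝ≥0∞ :=
  eVariationOn (fun t => γ t) Set.univ

/-- A metric space is a length space if the distance between any two points is the
infimum of the lengths of paths joining them. -/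
def IsLengthSpace (X : Type*) [MetricSpace X] : Prop :=
  ∀ x y : X, edist x y = ⨅ γ : Path x y, pathLength γ

/-- A metric space is geodesic if any two points are joined by a path whose length
realizes the distance. -/
def IsGeodesicSpace (X : Type*) [MetricSpace X] : Prop :=
  ∀ x y : X, ∃ γ : Path x y, pathLength γ = edist x y

/-! ## Peano spaces, Jordan curves and cyclic elements -/

/-- A Peano space: a compact connected locally connected metric space. -/
def IsPeano (X : Type*) [MetricSpace X] : Prop :=
  CompactSpace X ∧ ConnectedSpace X ∧ LocallyConnectedSpace X

/-- A Jordan curve: a subset homeomorphic to the 1-sphere. -/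
def IsJordanCurve {X : Type*} [TopologicalSpace X] (J : Set X) : Prop :=
  Nonempty (↥J ≃ₜ ↥Circle1)

/-- A set is cyclicly connected if every pair of distinct points of it lies on a common
Jordan curve contained in it. -/
def CycliclyConnected {X : Type*} [TopologicalSpace X] (A : Set X) : Prop :=
  ∀ x ∈ A, ∀ y ∈ A, x ≠ y → ∃ J : Set X, J ⊆ A ∧ IsJordanCurve J ∧ x ∈ J ∧ y ∈ J

/-- A maximal cyclic subset: a nondegenerate cyclicly connected subset which is not a
proper subset of any cyclicly connected subset. -/
def IsMaximalCyclic {X : Type*} [TopologicalSpace X] (A : Set X) : Prop :=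
  A.Nontrivial ∧ CycliclyConnected A ∧ ∀ B : Set X, CycliclyConnected B → A ⊆ B → A = B

/-- A subcontinuum: a compact connected (hence nonempty) subset. -/
def IsSubcontinuum {X : Type*} [TopologicalSpace X] (C : Set X) : Prop :=
  IsCompact C ∧ IsConnected C

/-- `b` is a boundary component of the subset `T` (viewed as a subspace). -/
def IsBoundaryComponentOf {X : Type*} [TopologicalSpace X] (T b : Set X) : Prop :=
  ∃ b' ∈ surfaceBoundaryComponents ↥T, b = Subtype.val '' b'

/-- An admissible subcontinuum: it meets every maximal cyclic subset `T` in at most a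
point or in a boundary component of `T`. -/
def IsAdmissible {X : Type*} [TopologicalSpace X] (C : Set X) : Prop :=
  IsSubcontinuum C ∧
    ∀ T : Set X, IsMaximalCyclic T →
      ((T ∩ C).Subsingleton ∨ IsBoundaryComponentOf T (T ∩ C))

/-- A 1-cactoid: a Peano space all of whose maximal cyclic subsets are homeomorphic to
the 1-sphere. -/
def IsOneCactoid (X : Type*) [MetricSpace X] : Prop :=
  IsPeano X ∧ ∀ T : Set X, IsMaximalCyclic T → Nonempty (↥T ≃ₜ ↥Circle1)

/-- A subset homeomorphic to the 2-sphere or the closed 2-disc. -/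
def SphereOrDisc {X : Type*} [TopologicalSpace X] (T : Set X) : Prop :=
  Nonempty (↥T ≃ₜ ↥Sphere2) ∨ Nonempty (↥T ≃ₜ ↥Disc2)

/-! ## Generalized cactoids -/

/-- A generalized cactoid. -/
def IsGeneralizedCactoid (X : Type*) [MetricSpace X] : Prop :=
  IsPeano X ∧ (∀ T : Set X, IsMaximalCyclic T → IsCompactSurface ↥T) ∧
  {T : Set X | IsMaximalCyclic T ∧ ¬ SphereOrDisc T}.Finite ∧
  ∃ (n : ℕ) (C : Fin n → Set X),
    (∀ i, IsAdmissible (C i)) ∧ (Pairwise fun i j => Disjoint (C i) (C j)) ∧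
    ∀ T b : Set X, IsMaximalCyclic T → IsBoundaryComponentOf T b → b ⊆ ⋃ i, C i

/-- A pre-boundary consisting of `n` disjoint admissible subcontinua, each containing a
boundary component of some maximal cyclic subset, which together cover all boundary
components of all maximal cyclic subsets. -/
def IsPreBoundaryOfSize {X : Type*} [TopologicalSpace X] (n : ℕ) (P : Set X) : Prop :=
  ∃ C : Fin n → Set X,
    (∀ i, IsAdmissible (C i)) ∧ (Pairwise fun i j => Disjoint (C i) (C j)) ∧
    (∀ i, ∃ T b : Set X, IsMaximalCyclic T ∧ IsBoundaryComponentOf T b ∧ b ⊆ C i) ∧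
    (∀ T b : Set X, IsMaximalCyclic T → IsBoundaryComponentOf T b → b ⊆ ⋃ i, C i) ∧
    P = ⋃ i, C i

def IsPreBoundary {X : Type*} [TopologicalSpace X] (P : Set X) : Prop :=
  ∃ n, IsPreBoundaryOfSize n P

/-- A minimal pre-boundary: one with the minimal possible number of pieces. -/
def IsMinimalPreBoundary {X : Type*} [TopologicalSpace X] (P : Set X) : Prop :=
  ∃ n, IsPreBoundaryOfSize n P ∧ ∀ (m : ℕ) (Q : Set X), IsPreBoundaryOfSize m Q → n ≤ m

/-- The boundary of a generalized cactoid: the union of all minimal pre-boundaries. -/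
def cactoidBoundary (X : Type*) [TopologicalSpace X] : Set X :=
  ⋃₀ {P : Set X | IsMinimalPreBoundary P}

/-- The boundary components of a generalized cactoid: the connected components of its
boundary. -/
def cactoidBoundaryComponents (X : Type*) [TopologicalSpace X] : Set (Set X) :=
  {b | ∃ x ∈ cactoidBoundary X, b = connectedComponentIn (cactoidBoundary X) x}

/-- The connectivity number of a generalized cactoid: the sum of the reduced
connectivity numbers of its maximal cyclic subsets plus the number of its boundary
components. -/
noncomputable def cactoidConnNum (X : Type*) [TopologicalSpace X] : ℤ :=
  (∑ᶠ T ∈ {T : Set X | IsMaximalCyclic T}, redConnNum ↥T) +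
    ((cactoidBoundaryComponents X).ncard : ℤ)

/-! ## Bundled spaces -/

structure BundledMet where
  carrier : Type
  [str : MetricSpace carrier]

attribute [instance] BundledMet.str

structure BundledTop where
  carrier : Type
  [str : TopologicalSpace carrier]

attribute [instance] BundledTop.str

/-! ## Metric two-point identifications -/

/-- `p : A → B` is (the projection of) a metric 2-point identification: it glues exactly
two distinct points `x₁, x₂` of `A` and carries the corresponding quotient metric. -/
def IsTwoPointIdentification {A B : Type*} [MetricSpace A] [MetricSpace B] (p : A → B) : Prop :=
  Function.Surjective p ∧ ∃ x₁ x₂ : A, x₁ ≠ x₂ ∧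
    (∀ a b : A, p a = p b ↔ (a = b ∨ (a = x₁ ∧ b = x₂) ∨ (a = x₂ ∧ b = x₁))) ∧
    ∀ a b : A, dist (p a) (p b) =
      min (dist a b) (min (dist a x₁ + dist x₂ b) (dist a x₂ + dist x₁ b))

/-- `Y` is obtained from `X` by a successive application of `k` metric 2-point
identifications, exactly `k₀` of which are boundary identifications with respect to the
subset `B ⊆ X`. -/
def ObtainedByIdentifications (X : Type) [MetricSpace X] (B : Set X) (k k0 : ℕ)
    (Y : Type) [MetricSpace Y] : Prop :=
  ∃ (Z : ℕ → BundledMet) (p : ∀ i : ℕ, (Z i).carrier → (Z (i + 1)).carrier)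
    (e : X ≃ᵢ (Z 0).carrier) (f : (Z k).carrier ≃ᵢ Y) (q : ∀ i : ℕ, X → (Z i).carrier),
    (∀ i, i < k → IsTwoPointIdentification (p i)) ∧
    (∀ x, q 0 x = e x) ∧ (∀ i x, q (i + 1) x = p i (q i x)) ∧
    {i : ℕ | i < k ∧ ∃ a b : (Z i).carrier,
        a ∈ q i '' B ∧ b ∈ q i '' B ∧ a ≠ b ∧ p i a = p i b}.ncard = k0

/-! ## Gromov–Hausdorff sequences of surfaces -/

/-- A sequence of (isometry classes of) compact length surfaces with connectivity
number `c`. -/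
def IsSurfaceGHSeq (c : ℕ) (K : ℕ → GHSpace) : Prop :=
  ∀ n, IsCompactSurface (K n).Rep ∧ IsLengthSpace (K n).Rep ∧ connNum (K n).Rep = c

/-- The structural description of the limit spaces in the Main Theorem: `X` is obtained
from a geodesic generalized cactoid `Y` by `k` successive metric 2-point
identifications, `k₀` of them boundary identifications, where the connectivity number
of `Y` is at most `c + k₀ - 2k`. -/
def MainThmRHS (c : ℕ) (X : Type) [MetricSpace X] : Prop :=
  ∃ (k k0 : ℕ) (Y : BundledMet),
    IsGeneralizedCactoid Y.carrier ∧ IsGeodesicSpace Y.carrier ∧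
    ObtainedByIdentifications Y.carrier (cactoidBoundary Y.carrier) k k0 X ∧
    cactoidConnNum Y.carrier ≤ (c : ℤ) + (k0 : ℤ) - 2 * (k : ℤ)

/-! ## Covering dimension -/

/-- `X` has covering dimension at most `n`: every open cover admits an open refinement
of order at most `n + 1`. -/
def CoveringDimLE (X : Type*) [TopologicalSpace X] (n : ℕ) : Prop :=
  ∀ U : Set (Set X), (∀ u ∈ U, IsOpen u) → ⋃₀ U = Set.univ →
    ∃ V : Set (Set X), (∀ v ∈ V, IsOpen v) ∧ ⋃₀ V = Set.univ ∧
      (∀ v ∈ V, ∃ u ∈ U, v ⊆ u) ∧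
      ∀ x : X, {v | v ∈ V ∧ x ∈ v}.encard ≤ (n : ℕ∞) + 1

/-! ## Curves in surfaces -/

/-- A continuous map from the circle is nullhomotopic if it is homotopic to a constant. -/
def IsNullhomotopic {X : Type*} [TopologicalSpace X] (f : C(↥Circle1, X)) : Prop :=
  ∃ y : X, f.Homotopic (ContinuousMap.const _ y)

/-- A contractible Jordan curve. -/
def IsContractibleJordanCurve {X : Type*} [TopologicalSpace X] (J : Set X) : Prop :=
  IsJordanCurve J ∧
    ∀ f : C(↥Circle1, X), Function.Injective f → Set.range f = J → IsNullhomotopic f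

/-- A non-contractible Jordan curve. -/
def IsNonContractibleJordanCurve {X : Type*} [TopologicalSpace X] (J : Set X) : Prop :=
  IsJordanCurve J ∧
    ∀ f : C(↥Circle1, X), Function.Injective f → Set.range f = J → ¬ IsNullhomotopic f

/-- A simple arc in a surface: an injective path whose endpoints lie on the boundary and
whose interior does not. -/
def IsSimpleArc {X : Type*} [TopologicalSpace X] (γ : C(I, X)) : Prop :=
  Function.Injective γ ∧ γ 0 ∈ surfaceBoundary X ∧ γ 1 ∈ surfaceBoundary X ∧
    ∀ t : I, t ≠ 0 → t ≠ 1 → γ t ∉ surfaceBoundary X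

/-- A subset separates the space if its complement is disconnected. -/
def SeparatesSpace {X : Type*} [TopologicalSpace X] (A : Set X) : Prop :=
  ¬ IsPreconnected Aᶜ

/-- The arc `γ` forms a contractible Jordan curve together with a subarc of some
boundary component. -/
def FormsContractibleJordanWithBoundary {X : Type*} [TopologicalSpace X]
    (γ : C(I, X)) : Prop :=
  ∃ β : C(I, X), Function.Injective β ∧ Set.range β ⊆ surfaceBoundary X ∧
    β 0 = γ 0 ∧ β 1 = γ 1 ∧ IsContractibleJordanCurve (Set.range γ ∪ Set.range β)

/-- `z` separates `x` and `y` inside the subset `A`: both lie in `A \ {z}` and no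
connected subset of `A \ {z}` contains both. -/
def SeparatesIn {X : Type*} [TopologicalSpace X] (A : Set X) (z x y : X) : Prop :=
  x ∈ A \ {z} ∧ y ∈ A \ {z} ∧
    ∀ C : Set X, C ⊆ A \ {z} → IsPreconnected C → ¬ (x ∈ C ∧ y ∈ C)

/-! ## Metric doubles -/

/-- `D` together with the two canonical maps `ip, im : X → D` is the metric double of
`X` along the subset `B`. -/
structure IsMetricDouble (X : Type*) [MetricSpace X] (B : Set X) (D : Type*)
    [MetricSpace D] (ip im : X → D) : Prop where
  isom_p : Isometry ip
  isom_m : Isometry im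
  surj : Set.range ip ∪ Set.range im = Set.univ
  agree : ∀ z ∈ B, ip z = im z
  dist_mix : ∀ a b : X, dist (ip a) (im b) = ⨅ z : ↥B, (dist a (z : X) + dist (z : X) b)

/-- Regularity of a sequence of doubles: there is no sequence of non-contractible
Jordan curves in the doubles with vanishing diameters. -/
def RegularDoubleSeq (D : ℕ → Type) [∀ n, MetricSpace (D n)] : Prop :=
  ∀ J : ∀ n, Set (D n), (∀ n, IsNonContractibleJordanCurve (J n)) →
    0 < ⨅ n, Metric.diam (J n)

/-- The copy `A^+` (or `A^-`) in the double limit corresponding to a subset `A` of the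
limit `X`, via the isometric identification `j` of `X` with `X^+` (resp. `X^-`). -/
def plusCopy {Z D : Type*} {X : Set Z} {Xp : Set D} (j : ↥X → ↥Xp) (A : Set Z) :
    Set D :=
  (fun x => ((j x : ↥Xp) : D)) '' {x : ↥X | (x : Z) ∈ A}

/-! ## Riemannian and polyhedral surfaces -/

/-- The Riemannian length integrand `√(g_{γ(t)}(γ'(t), γ'(t)))`. -/
noncomputable def riemLengthIntegrand (g : (ℝ × ℝ) → (ℝ × ℝ) → (ℝ × ℝ) → ℝ)
    (γ : ℝ → ℝ × ℝ) (t : ℝ) : ℝ :=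
  Real.sqrt (g (γ t) (deriv γ t) (deriv γ t))

/-- A compact connected smooth Riemannian 2-manifold, as a metric space: a compact
length surface such that around every point there is a chart in which the length of
every C¹ curve is computed by a smooth positive definite symmetric bilinear metric. -/
def IsSmoothRiemannianSurface (X : Type*) [MetricSpace X] : Prop :=
  IsCompactSurface X ∧ IsLengthSpace X ∧
  ∀ x : X, ∃ (U : Set X) (V : Set (ℝ × ℝ)) (φ : X → ℝ × ℝ) (ψ : ℝ × ℝ → X)
      (g : (ℝ × ℝ) → (ℝ × ℝ) → (ℝ × ℝ) → ℝ),
    IsOpen U ∧ x ∈ U ∧ (∃ V' : Set (ℝ × ℝ), IsOpen V' ∧ V = V' ∩ HalfPlane) ∧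
    ContinuousOn φ U ∧ φ '' U = V ∧ ContinuousOn ψ V ∧
    (∀ y ∈ U, ψ (φ y) = y) ∧ (∀ v ∈ V, φ (ψ v) = v) ∧
    (∀ m : ℕ, ContDiffOn ℝ m
      (fun pq : (ℝ × ℝ) × (ℝ × ℝ) × (ℝ × ℝ) => g pq.1 pq.2.1 pq.2.2)
      (V ×ˢ ((Set.univ : Set (ℝ × ℝ)) ×ˢ (Set.univ : Set (ℝ × ℝ))))) ∧
    (∀ p u v, g p u v = g p v u) ∧
    (∀ p (a : ℝ) u u' v, g p (a • u + u') v = a * g p u v + g p u' v) ∧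
    (∀ p ∈ V, ∀ u : ℝ × ℝ, u ≠ 0 → 0 < g p u u) ∧
    ∀ (cur : ℝ → X) (a b : ℝ), a ≤ b → Set.MapsTo cur (Set.Icc a b) U →
      ContDiffOn ℝ 1 (φ ∘ cur) (Set.Icc a b) →
      eVariationOn cur (Set.Icc a b) =
        ENNReal.ofReal (∫ t in a..b, riemLengthIntegrand g (φ ∘ cur) t)

/-- A polyhedral surface: a compact length surface which is flat (locally isometric to
a subset of the Euclidean half plane) away from finitely many singular points. -/
def IsPolyhedralSurface (X : Type*) [MetricSpace X] : Prop :=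
  IsCompactSurface X ∧ IsLengthSpace X ∧
  ∃ F : Set X, F.Finite ∧ ∀ x : X, x ∉ F →
    ∃ (U : Set X) (W : Set (EuclideanSpace ℝ (Fin 2))),
      IsOpen U ∧ x ∈ U ∧ W ⊆ EHalfPlane ∧ Nonempty (↥U ≃ᵢ ↥W)

end

/-! ## Homotopy classes of segments of curves -/

section Segments

variable {X Y Z : Type*} [TopologicalSpace X] [TopologicalSpace Y] [TopologicalSpace Z]

theorem pclass_trans_right_cancel {u v w : X} {κ κ' : Path.Homotopic.Quotient u v}
    {τ : Path.Homotopic.Quotient v w} (h : κ.trans τ = κ'.trans τ) : κ = κ' := by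
  have := congrArg (fun z => z.trans τ.symm) h
  simpa using this

theorem pclass_trans_left_cancel {u v w : X} {τ : Path.Homotopic.Quotient u v}
    {κ κ' : Path.Homotopic.Quotient v w} (h : τ.trans κ = τ.trans κ') : κ = κ' := by
  have := congrArg (fun z => τ.symm.trans z) h
  simpa [← Path.Homotopic.Quotient.trans_assoc] using this

/-- The restriction of a curve to an interval, as a path with prescribed endpoints. -/
def segPath (f : C(ℝ, X)) (a b : ℝ) {u v : X} (hu : f a = u) (hv : f b = v) : Path u v where
  toFun t := f (a + t * (b - a))
  source' := by simp [hu]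
  target' := by simp [hv]

/-- The homotopy class of the restriction of a curve to an interval. -/
def segClass (f : C(ℝ, X)) (a b : ℝ) {u v : X} (hu : f a = u) (hv : f b = v) :
    Path.Homotopic.Quotient u v :=
  Path.Homotopic.Quotient.mk (segPath f a b hu hv)

theorem segPath_apply (f : C(ℝ, X)) (a b : ℝ) {u v : X} (hu : f a = u) (hv : f b = v) (t : I) :
    segPath f a b hu hv t = f (a + t * (b - a)) := rfl

theorem range_segPath_subset (f : C(ℝ, X)) {a b : ℝ} (hab : a ≤ b) {u v : X} (hu : f a = u)
    (hv : f b = v) {W : Set X} (h : ∀ t ∈ Icc a b, f t ∈ W) :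
    range (segPath f a b hu hv) ⊆ W := by
  rintro _ ⟨t, rfl⟩
  refine h _ ⟨?_, ?_⟩ <;> nlinarith [t.2.1, t.2.2]

theorem segClass_eq_map (f : C(ℝ, X)) (a b : ℝ) (p : Path a b) :
    segClass f a b rfl rfl = (Path.Homotopic.Quotient.mk p).map f := by
  have : Path.Homotopic.Quotient.mk p =
      Path.Homotopic.Quotient.mk (segPath (ContinuousMap.id ℝ) a b rfl rfl) :=
    Subsingleton.elim _ _
  rw [this]
  rfl

theorem segClass_self (f : C(ℝ, X)) (a : ℝ) {u : X} (hu hu' : f a = u) :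
    segClass f a a hu hu' = Path.Homotopic.Quotient.refl u := by
  subst hu
  rw [segClass_eq_map f a a (Path.refl a)]
  rfl

theorem segClass_trans (f : C(ℝ, X)) (a b c : ℝ) {u v w : X} (hu : f a = u) (hv : f b = v)
    (hw : f c = w) :
    (segClass f a b hu hv).trans (segClass f b c hv hw) = segClass f a c hu hw := by
  subst hu hv hw
  have p : Path a b := segPath (ContinuousMap.id ℝ) a b rfl rfl
  have q : Path b c := segPath (ContinuousMap.id ℝ) b c rfl rfl
  rw [segClass_eq_map f a b p, segClass_eq_map f b c q, segClass_eq_map f a c (p.trans q)]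
  simp only [← Path.Homotopic.Quotient.mk_map, ← Path.Homotopic.Quotient.mk_trans,
    Path.map_trans]

theorem segClass_symm (f : C(ℝ, X)) (a b : ℝ) {u v : X} (hu : f a = u) (hv : f b = v) :
    (segClass f a b hu hv).symm = segClass f b a hv hu := by
  apply pclass_trans_left_cancel (τ := segClass f a b hu hv)
  rw [segClass_trans, segClass_self]
  simp

theorem segClass_congr {f g : C(ℝ, X)} {a b c d : ℝ} {u v : X} {hu : f a = u} {hv : f b = v}
    {hu' : g c = u} {hv' : g d = v}
    (h : ∀ t ∈ Icc (0 : ℝ) 1, f (a + t * (b - a)) = g (c + t * (d - c))) :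
    segClass f a b hu hv = segClass g c d hu' hv' := by
  unfold segClass
  congr 1
  ext t
  exact h t t.2

theorem segClass_congr' {f g : C(ℝ, X)} {a b : ℝ} (hab : a ≤ b) {u v : X} {hu : f a = u}
    {hv : f b = v} {hu' : g a = u} {hv' : g b = v} (h : ∀ t ∈ Icc a b, f t = g t) :
    segClass f a b hu hv = segClass g a b hu' hv' :=
  segClass_congr fun t ht => h _ ⟨by nlinarith [ht.1, ht.2], by nlinarith [ht.1, ht.2]⟩

/-- Extension of a path to the real line. -/
noncomputable def pathExt {u v : X} (p : Path u v) : C(ℝ, X) := ⟨p.extend, p.continuous_extend⟩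

theorem pathExt_zero {u v : X} (p : Path u v) : pathExt p 0 = u := p.extend_zero

theorem pathExt_one {u v : X} (p : Path u v) : pathExt p 1 = v := p.extend_one

theorem pathExt_apply {u v : X} (p : Path u v) (t : I) : pathExt p t = p t :=
  p.extend_apply t.2

theorem segClass_pathExt {u v : X} (p : Path u v) :
    segClass (pathExt p) 0 1 (pathExt_zero p) (pathExt_one p) =
      Path.Homotopic.Quotient.mk p := by
  unfold segClass
  congr 1
  ext t
  rw [segPath_apply]
  simp [pathExt_apply]

/-- A subset in which any two paths with common endpoints are homotopic in the ambient space. -/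
def RelSimplyConnected (W : Set X) : Prop :=
  ∀ ⦃u v : X⦄ (p q : Path u v), range p ⊆ W → range q ⊆ W →
    Path.Homotopic.Quotient.mk p = Path.Homotopic.Quotient.mk q

theorem RelSimplyConnected.mono {V W : Set X} (hW : RelSimplyConnected W) (h : V ⊆ W) :
    RelSimplyConnected V :=
  fun _ _ p q hp hq => hW p q (hp.trans h) (hq.trans h)

theorem RelSimplyConnected.segClass_eq {W : Set X} (hW : RelSimplyConnected W) {f g : C(ℝ, X)}
    {a b c d : ℝ} (hab : a ≤ b) (hcd : c ≤ d) {u v : X} {hu : f a = u} {hv : f b = v}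
    {hu' : g c = u} {hv' : g d = v} (hf : ∀ t ∈ Icc a b, f t ∈ W) (hg : ∀ t ∈ Icc c d, g t ∈ W) :
    segClass f a b hu hv = segClass g c d hu' hv' :=
  hW _ _ (range_segPath_subset f hab hu hv hf) (range_segPath_subset g hcd hu' hv' hg)

theorem mk_map_eq_of_homotopic_const {f : C(X, Y)} {y : Y}
    (h : f.Homotopic (ContinuousMap.const X y)) {u v : X} (p q : Path u v) :
    (Path.Homotopic.Quotient.mk p).map f = (Path.Homotopic.Quotient.mk q).map f := by
  obtain ⟨F⟩ := h
  have hp : ((Path.Homotopic.Quotient.mk p).map f).trans (.mk (F.evalAt v)) =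
      (Path.Homotopic.Quotient.mk (F.evalAt u)).trans (.mk (p.map (map_continuous _))) :=
    Path.Homotopic.Quotient.eq.2 (Path.Homotopic.map_trans_evalAt F p)
  have hq : ((Path.Homotopic.Quotient.mk q).map f).trans (.mk (F.evalAt v)) =
      (Path.Homotopic.Quotient.mk (F.evalAt u)).trans (.mk (q.map (map_continuous _))) :=
    Path.Homotopic.Quotient.eq.2 (Path.Homotopic.map_trans_evalAt F q)
  have hpq : p.map (map_continuous (ContinuousMap.const X y)) =
      q.map (map_continuous (ContinuousMap.const X y)) := by
    ext t
    rfl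
  rw [hpq, ← hq] at hp
  exact pclass_trans_right_cancel hp

theorem relSimplyConnected_of_homotopic_const {W : Set X} {y : X}
    (h : (⟨Subtype.val, continuous_subtype_val⟩ : C(W, X)).Homotopic
      (ContinuousMap.const W y)) : RelSimplyConnected W := by
  intro u v p q hp hq
  have hu : u ∈ W := by simpa using hp ⟨0, rfl⟩
  have hv : v ∈ W := by simpa using hp ⟨1, rfl⟩
  let p' : Path (⟨u, hu⟩ : W) ⟨v, hv⟩ :=
    { toFun := fun t => ⟨p t, hp ⟨t, rfl⟩⟩, source' := by simp, target' := by simp }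
  let q' : Path (⟨u, hu⟩ : W) ⟨v, hv⟩ :=
    { toFun := fun t => ⟨q t, hq ⟨t, rfl⟩⟩, source' := by simp, target' := by simp }
  exact mk_map_eq_of_homotopic_const h p' q'

end Segments

/-! ## Geodesics and shortest essential loops -/

section Systole

variable {X : Type*} [MetricSpace X]

theorem exists_tendsto_hyperfilter [CompactSpace X] (F : ℕ → X) :
    ∃ x, Tendsto F (hyperfilter ℕ) (𝓝 x) := by
  obtain ⟨x, -, hx⟩ := isCompact_univ.ultrafilter_le_nhds ((hyperfilter ℕ).map F) (by simp)
  exact ⟨x, hx⟩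

theorem continuous_of_dist_le {f : ℝ → X} (h : ∀ s t, dist (f s) (f t) ≤ |s - t|) :
    Continuous f :=
  (LipschitzWith.of_dist_le_mul (K := 1) fun s t => by simp [Real.dist_eq, h s t]).continuous

theorem edist_add_le_pathLength {x y : X} (γ : Path x y) {s t : I} (hst : s ≤ t) :
    edist x (γ s) + edist (γ s) (γ t) + edist (γ t) y ≤ pathLength γ := by
  let u : ℕ → I := fun i => if i = 0 then 0 else if i = 1 then s else if i = 2 then t else 1
  have hu : Monotone u := by
    refine monotone_nat_of_le_succ fun n => ?_
    rcases n with _ | _ | _ | n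
    · exact s.2.1
    · exact hst
    · exact t.2.2
    · exact le_refl (1 : I)
  have := eVariationOn.sum_le (f := fun t => γ t) (s := univ) (n := 3) hu (fun _ => mem_univ _)
  simpa [Finset.sum_range_succ, u, edist_comm, pathLength] using this

theorem exists_almost_geodesic (h : IsLengthSpace X) (x y : X) {η : ℝ} (hη : 0 < η) :
    ∃ g : ℝ → X, g 0 = x ∧ dist (g (dist x y)) y ≤ η ∧
      ∀ s t, dist (g s) (g t) ≤ |s - t| + η := by
  have hlt : ⨅ γ : Path x y, pathLength γ < edist x y + ENNReal.ofReal η := by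
    rw [← h x y]
    exact ENNReal.lt_add_right (edist_ne_top _ _) (by simpa using hη)
  obtain ⟨γ, hγ⟩ := iInf_lt_iff.1 hlt
  have key : ∀ s t : I, s ≤ t →
      dist x (γ s) + dist (γ s) (γ t) + dist (γ t) y ≤ dist x y + η := by
    intro s t hst
    have := (edist_add_le_pathLength γ hst).trans hγ.le
    simp only [edist_dist] at this
    rwa [← ENNReal.ofReal_add (by positivity) (by positivity),
      ← ENNReal.ofReal_add (by positivity) (by positivity),
      ← ENNReal.ofReal_add (by positivity) (by positivity),
      ENNReal.ofReal_le_ofReal_iff (by positivity)] at this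
  have hivt : ∀ s : Icc 0 (dist x y), ∃ t : I, dist x (γ t) = s := by
    intro s
    have hc : ContinuousOn (fun t => dist x (γ t)) univ := by fun_prop
    have := isPreconnected_univ.intermediate_value (mem_univ (0 : I)) (mem_univ (1 : I)) hc
    obtain ⟨t, -, ht⟩ := this (show (s : ℝ) ∈ Icc (dist x (γ 0)) (dist x (γ 1)) by
      simp)
    exact ⟨t, ht⟩
  choose τ hτ using hivt
  let pr : ℝ → Icc 0 (dist x y) := projIcc 0 (dist x y) dist_nonneg
  refine ⟨fun s => γ (τ (pr s)), ?_, ?_, ?_⟩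
  · have := hτ (pr 0)
    simp only [pr, projIcc_left] at this ⊢
    exact (dist_eq_zero.1 this).symm
  · have h1 := hτ (pr (dist x y))
    simp only [pr, projIcc_right] at h1 ⊢
    have := key _ _ (le_refl (τ ⟨dist x y, right_mem_Icc.2 dist_nonneg⟩))
    rw [h1] at this
    simp only [dist_self] at this
    linarith
  · have hmain : ∀ s t : ℝ, τ (pr s) ≤ τ (pr t) →
        dist (γ (τ (pr s))) (γ (τ (pr t))) ≤ |s - t| + η := by
      intro s t hst
      have h1 := key _ _ hst
      have h2 := dist_triangle x (γ (τ (pr t))) y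
      have h3 := hτ (pr s)
      have h4 := hτ (pr t)
      have h5 : |(pr s : ℝ) - pr t| ≤ |s - t| := by
        simpa [pr] using abs_projIcc_sub_projIcc (a := 0) (b := dist x y) (c := s) (d := t)
          dist_nonneg
      have h6 := neg_abs_le ((pr s : ℝ) - pr t)
      linarith
    intro s t
    rcases le_total (τ (pr s)) (τ (pr t)) with hst | hst
    · exact hmain s t hst
    · rw [dist_comm, abs_sub_comm]
      exact hmain t s hst

theorem exists_geodesic [CompactSpace X] (h : IsLengthSpace X) (x y : X) :
    ∃ f : C(ℝ, X), f 0 = x ∧ f (dist x y) = y ∧ ∀ s t, dist (f s) (f t) ≤ |s - t| := by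
  choose g hg0 hgd hg using fun n : ℕ =>
    exists_almost_geodesic h x y (η := 1 / ((n : ℝ) + 1)) (by positivity)
  choose f hf using fun s => exists_tendsto_hyperfilter fun n => g n s
  have hη : Tendsto (fun n : ℕ => 1 / ((n : ℝ) + 1)) (hyperfilter ℕ) (𝓝 0) :=
    tendsto_one_div_add_atTop_nhds_zero_nat.mono_left Nat.hyperfilter_le_atTop
  have hlip : ∀ s t, dist (f s) (f t) ≤ |s - t| := by
    intro s t
    have h1 := (hf s).dist (hf t)
    have h2 := hη.const_add (|s - t|)
    rw [add_zero] at h2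
    exact le_of_tendsto_of_tendsto' h1 h2 fun n => hg n s t
  refine ⟨⟨f, continuous_of_dist_le hlip⟩, ?_, ?_, hlip⟩
  · refine tendsto_nhds_unique (hf 0) ?_
    simp only [hg0]
    exact tendsto_const_nhds
  · have h1 := (hf (dist x y)).dist (tendsto_const_nhds (x := y))
    exact dist_le_zero.1 (le_of_tendsto_of_tendsto' h1 hη fun n => hgd n)

/-- A homotopy class of paths is represented by a `1`-Lipschitz curve of length `L`. -/
def HasLength {u v : X} (κ : Path.Homotopic.Quotient u v) (L : ℝ) : Prop :=
  0 ≤ L ∧ ∃ (f : C(ℝ, X)) (hu : f 0 = u) (hv : f L = v),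
    (∀ s t, dist (f s) (f t) ≤ |s - t|) ∧ segClass f 0 L hu hv = κ

theorem HasLength.of_segClass {f : C(ℝ, X)} (hf : ∀ s t, dist (f s) (f t) ≤ |s - t|) {a b : ℝ}
    (hab : a ≤ b) {u v : X} (hu : f a = u) (hv : f b = v) :
    HasLength (segClass f a b hu hv) (b - a) := by
  refine ⟨by linarith, f.comp ⟨fun t => a + t, by fun_prop⟩, by simpa using hu,
    by simpa using hv, fun s t => ?_, ?_⟩
  · simpa using hf (a + s) (a + t)
  · refine segClass_congr fun t _ => ?_
    simp

theorem HasLength.symm {u v : X} {κ : Path.Homotopic.Quotient u v} {L : ℝ} (h : HasLength κ L) :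
    HasLength κ.symm L := by
  obtain ⟨hL, f, hu, hv, hf, rfl⟩ := h
  refine ⟨hL, f.comp ⟨fun t => L - t, by fun_prop⟩, by simpa using hv, by simpa using hu,
    fun s t => ?_, ?_⟩
  · have := hf (L - s) (L - t)
    rw [show L - s - (L - t) = t - s by ring, abs_sub_comm] at this
    exact this
  · rw [segClass_symm]
    refine segClass_congr fun t _ => ?_
    simp only [ContinuousMap.comp_apply, ContinuousMap.coe_mk]
    congr 1
    ring

theorem HasLength.trans {u v w : X} {κ : Path.Homotopic.Quotient u v}
    {κ' : Path.Homotopic.Quotient v w} {L L' : ℝ} (h : HasLength κ L) (h' : HasLength κ' L') :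
    HasLength (κ.trans κ') (L + L') := by
  obtain ⟨hL, f, hu, hv, hf, rfl⟩ := h
  obtain ⟨hL', g, hu', hv', hg, rfl⟩ := h'
  let k : ℝ → X := fun t => if t ≤ L then f t else g (t - L)
  have hk1 : ∀ t ≤ L, k t = f t := fun t ht => by simp [k, ht]
  have hk2 : ∀ t, L ≤ t → k t = g (t - L) := by
    intro t ht
    rcases ht.eq_or_lt with rfl | ht
    · simp [k, hv, hu']
    · simp [k, not_le.2 ht]
  have hmid : ∀ s t, s ≤ L → L ≤ t → dist (k s) (k t) ≤ |s - t| := by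
    intro s t hs ht
    have h1 := hf s L
    have h2 := hg 0 (t - L)
    rw [hk1 s hs, hk2 t ht]
    rw [abs_of_nonpos (by linarith)] at h1 h2 ⊢
    have := dist_triangle (f s) v (g (t - L))
    rw [hv] at h1
    rw [hu'] at h2
    linarith
  have hk : ∀ s t, dist (k s) (k t) ≤ |s - t| := by
    intro s t
    rcases le_total s L with hs | hs <;> rcases le_total t L with ht | ht
    · rw [hk1 s hs, hk1 t ht]
      exact hf s t
    · exact hmid s t hs ht
    · rw [dist_comm, abs_sub_comm]
      exact hmid t s ht hs
    · rw [hk2 s hs, hk2 t ht]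
      simpa using hg (s - L) (t - L)
  let K : C(ℝ, X) := ⟨k, continuous_of_dist_le hk⟩
  have e0 : K 0 = u := (hk1 0 hL).trans hu
  have e1 : K L = v := (hk1 L le_rfl).trans hv
  have e2 : K (L + L') = w := by
    refine (hk2 _ (by linarith)).trans ?_
    simpa using hv'
  refine ⟨by positivity, K, e0, e2, hk, ?_⟩
  rw [← segClass_trans K 0 L (L + L') e0 e1 e2]
  congr 1
  · exact segClass_congr' hL fun t ht => hk1 t ht.2
  · refine segClass_congr fun t ht => ?_
    refine (hk2 _ (by nlinarith [ht.1])).trans ?_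
    congr 1
    ring

theorem HasLength.eq_refl {u : X} {κ : Path.Homotopic.Quotient u u} (h : HasLength κ 0) :
    κ = Path.Homotopic.Quotient.refl u := by
  obtain ⟨-, f, hu, hv, -, rfl⟩ := h
  exact segClass_self f 0 hu hv

theorem exists_path_of_dist_lt [CompactSpace X] (h : IsLengthSpace X) {x y : X} {r : ℝ}
    (hr : dist x y < r) : ∃ p : Path x y, range p ⊆ ball x r := by
  obtain ⟨f, h0, h1, hf⟩ := exists_geodesic h x y
  refine ⟨segPath f 0 (dist x y) h0 h1, range_segPath_subset f dist_nonneg h0 h1 fun t ht => ?_⟩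
  have := hf t 0
  rw [h0, sub_zero, abs_of_nonneg ht.1] at this
  exact mem_ball.2 (by linarith [ht.2])

theorem segClass_eq_refl_of_close [CompactSpace X] (h : IsLengthSpace X) {δ : ℝ}
    (hδ : ∀ x : X, RelSimplyConnected (ball x δ)) {f g : C(ℝ, X)} {K : ℝ} {N : ℕ} (hN : 0 < N)
    (hKN : K / N < δ / 4) (hK : 0 ≤ K) (hf : ∀ s t, dist (f s) (f t) ≤ K * |s - t|)
    (hg : ∀ s t, dist (g s) (g t) ≤ K * |s - t|)
    (hfg : ∀ i ≤ N, dist (f ((i : ℝ) / N)) (g ((i : ℝ) / N)) < δ / 4) {u v : X} (hu : f 0 = u)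
    (hu' : f 1 = u) (hv : g 0 = v) (hv' : g 1 = v)
    (hgr : segClass g 0 1 hv hv' = Path.Homotopic.Quotient.refl v) :
    segClass f 0 1 hu hu' = Path.Homotopic.Quotient.refl u := by
  have hN' : (0 : ℝ) < N := by exact_mod_cast hN
  have hδ0 : 0 < δ := by
    have : 0 ≤ K / N := by positivity
    linarith
  have huv : dist u v < δ / 4 := by
    have := hfg 0 (Nat.zero_le _)
    simpa [hu, hv] using this
  obtain ⟨ρ₀, hρ₀⟩ := exists_path_of_dist_lt h huv
  have key : ∀ i : ℕ, i ≤ N → ∀ t : ℝ, t = i / N → ∀ (a b : X) (ha : f t = a) (hb : g t = b)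
      (ρ : Path a b), range ρ ⊆ ball a (δ / 4) →
      (segClass f 0 t hu ha).trans (.mk ρ) =
        (Path.Homotopic.Quotient.mk ρ₀).trans (segClass g 0 t hv hb) := by
    intro i
    induction i with
    | zero =>
      intro _ t ht a b ha hb ρ hρ
      obtain rfl : t = 0 := by simpa using ht
      subst hu hv ha hb
      rw [segClass_self, segClass_self, Path.Homotopic.Quotient.refl_trans,
        Path.Homotopic.Quotient.trans_refl]
      exact hδ _ _ _ (hρ.trans (ball_subset_ball (by linarith)))
        (hρ₀.trans (ball_subset_ball (by linarith)))
    | succ i ih =>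
      intro hi t' ht' a' b' ha' hb' ρ' hρ'
      obtain ⟨t, ht⟩ : ∃ t : ℝ, t = i / N := ⟨_, rfl⟩
      have htt : t' - t = 1 / N := by
        rw [ht, ht']
        push_cast
        ring
      have htt' : t ≤ t' := by
        have : (0 : ℝ) < 1 / N := by positivity
        linarith
      have hstep : K * (t' - t) < δ / 4 := by
        rw [htt, mul_one_div]
        exact hKN
      have hd : dist (f t) (g t) < δ / 4 := by
        rw [ht]
        exact hfg i (by omega)
      obtain ⟨ρ, hρ⟩ := exists_path_of_dist_lt h hd
      have hft : ∀ s ∈ Icc t t', dist (f s) (f t) < δ / 4 := by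
        intro s hs
        refine (hf s t).trans_lt (lt_of_le_of_lt ?_ hstep)
        rw [abs_of_nonneg (by linarith [hs.1])]
        exact mul_le_mul_of_nonneg_left (by linarith [hs.2]) hK
      have hgt : ∀ s ∈ Icc t t', dist (g s) (g t) < δ / 4 := by
        intro s hs
        refine (hg s t).trans_lt (lt_of_le_of_lt ?_ hstep)
        rw [abs_of_nonneg (by linarith [hs.1])]
        exact mul_le_mul_of_nonneg_left (by linarith [hs.2]) hK
      have hsq : (segClass f t t' rfl ha').trans (.mk ρ') =
          (Path.Homotopic.Quotient.mk ρ).trans (segClass g t t' rfl hb') := by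
        refine hδ (f t) ((segPath f t t' rfl ha').trans ρ') (ρ.trans (segPath g t t' rfl hb')) ?_ ?_
        · rw [Path.trans_range]
          refine union_subset (range_segPath_subset f htt' _ _ fun s hs => ?_)
            (hρ'.trans fun z hz => ?_)
          · exact mem_ball.2 (by linarith [hft s hs])
          · have h1 := hft t' ⟨htt', le_rfl⟩
            have h2 := mem_ball.1 hz
            rw [ha'] at h1
            exact mem_ball.2 (by linarith [dist_triangle z a' (f t)])
        · rw [Path.trans_range]
          refine union_subset (hρ.trans (ball_subset_ball (by linarith)))
            (range_segPath_subset g htt' _ _ fun s hs => ?_)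
          have h1 := hgt s hs
          rw [dist_comm] at hd
          exact mem_ball.2 (by linarith [dist_triangle (g s) (g t) (f t)])
      have := ih (by omega) t ht _ _ rfl rfl ρ hρ
      rw [← segClass_trans f 0 t t' hu rfl ha', ← segClass_trans g 0 t t' hv rfl hb',
        Path.Homotopic.Quotient.trans_assoc, hsq, ← Path.Homotopic.Quotient.trans_assoc, this,
        Path.Homotopic.Quotient.trans_assoc]
  have := key N le_rfl 1 (by field_simp) u v hu' hv' ρ₀ hρ₀
  rw [hgr, Path.Homotopic.Quotient.trans_refl] at this
  apply pclass_trans_right_cancel (τ := .mk ρ₀)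
  rw [this, Path.Homotopic.Quotient.refl_trans]

theorem exists_short_essential_loop [CompactSpace X] (h : IsLengthSpace X) {δ : ℝ} (hδ0 : 0 < δ)
    (hδ : ∀ x : X, RelSimplyConnected (ball x δ)) {f : C(ℝ, X)} {u : X} (hu : f 0 = u)
    (hu' : f 1 = u) {ε : ℝ} (hε : ∀ s ∈ Icc (0 : ℝ) 1, ∀ t ∈ Icc (0 : ℝ) 1, dist (f s) (f t) ≤ ε)
    (hf : segClass f 0 1 hu hu' ≠ Path.Homotopic.Quotient.refl u) :
    ∃ (v : X) (κ : Path.Homotopic.Quotient v v) (L : ℝ), L ≤ 3 * ε ∧ HasLength κ L ∧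
      κ ≠ Path.Homotopic.Quotient.refl v := by
  by_contra! hcon
  obtain ⟨r, hr, hunif⟩ := Metric.uniformContinuousOn_iff.1
    (isCompact_Icc.uniformContinuousOn_of_continuous
      (f.continuous.continuousOn (s := Icc (0 : ℝ) 1))) δ hδ0
  obtain ⟨N, hN⟩ := exists_nat_one_div_lt hr
  have key : ∀ i : ℕ, ∀ t : ℝ, t = i / (N + 1 : ℝ) → t ≤ 1 → ∀ (v : X) (hv : f t = v)
      (κ : Path.Homotopic.Quotient u v), HasLength κ (dist u v) → segClass f 0 t hu hv = κ := by
    intro i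
    induction i with
    | zero =>
      intro t ht _ v hv κ hκ
      obtain rfl : t = 0 := by simpa using ht
      obtain rfl : u = v := hu.symm.trans hv
      rw [dist_self] at hκ
      rw [hκ.eq_refl, segClass_self]
    | succ i ih =>
      intro t' ht' ht1 v' hv' κ' hκ'
      obtain ⟨t, ht⟩ : ∃ t : ℝ, t = i / (N + 1 : ℝ) := ⟨_, rfl⟩
      have htt : t' - t = 1 / (N + 1 : ℝ) := by
        rw [ht, ht']
        push_cast
        ring
      have htt' : t ≤ t' := by
        have : (0 : ℝ) < 1 / (N + 1 : ℝ) := by positivity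
        linarith
      have ht0 : 0 ≤ t := by
        rw [ht]
        positivity
      have hmem : ∀ s ∈ Icc t t', s ∈ Icc (0 : ℝ) 1 := fun s hs =>
        ⟨ht0.trans hs.1, hs.2.trans ht1⟩
      have hft : ∀ s ∈ Icc t t', dist (f s) (f t) < δ := by
        intro s hs
        refine hunif s (hmem s hs) t (hmem t ⟨le_rfl, htt'⟩) ?_
        rw [Real.dist_eq, abs_of_nonneg (by linarith [hs.1])]
        linarith [hs.2]
      obtain ⟨p, hp0, hp1, hp⟩ := exists_geodesic h u (f t)
      have hκ := HasLength.of_segClass hp (dist_nonneg (x := u) (y := f t)) hp0 hp1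
      rw [sub_zero] at hκ
      obtain ⟨q, hq0, hq1, hq⟩ := exists_geodesic h (f t) v'
      have hρ := HasLength.of_segClass hq (dist_nonneg (x := f t) (y := v')) hq0 hq1
      rw [sub_zero] at hρ
      have h1 : segClass f t t' rfl hv' = segClass q 0 (dist (f t) v') hq0 hq1 := by
        refine (hδ (f t)).segClass_eq htt' dist_nonneg hft fun s hs => ?_
        have h2 := hq s 0
        rw [hq0, sub_zero, abs_of_nonneg hs.1] at h2
        have h3 := hft t' ⟨htt', le_rfl⟩
        rw [hv', dist_comm] at h3
        exact mem_ball.2 (by linarith [hs.2])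
      have h2 := ih t ht (htt'.trans ht1) _ rfl _ hκ
      have hloop := hcon u _ _ ?_ ((hκ.trans hρ).trans hκ'.symm)
      · rw [← segClass_trans f 0 t t' hu rfl hv', h2, h1]
        apply pclass_trans_right_cancel (τ := κ'.symm)
        rw [hloop, Path.Homotopic.Quotient.trans_symm]
      · have a1 := hε 0 ⟨le_rfl, zero_le_one⟩ t (hmem t ⟨le_rfl, htt'⟩)
        have a2 := hε t (hmem t ⟨le_rfl, htt'⟩) t' (hmem t' ⟨htt', le_rfl⟩)
        have a3 := hε 0 ⟨le_rfl, zero_le_one⟩ t' (hmem t' ⟨htt', le_rfl⟩)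
        rw [hu] at a1 a3
        rw [hv'] at a2 a3
        linarith
  refine hf (key (N + 1) 1 ?_ le_rfl u hu' _ ?_)
  · push_cast
    field_simp
  · refine ⟨dist_nonneg, .const ℝ u, rfl, rfl, fun s t => by simp, ?_⟩
    rw [← segClass_self f 0 hu hu]
    exact segClass_congr fun t _ => by simp [hu]

theorem exists_minimal_essential_length [CompactSpace X] (h : IsLengthSpace X) {δ : ℝ}
    (hδ0 : 0 < δ) (hδ : ∀ x : X, RelSimplyConnected (ball x δ)) {S : Set ℝ}
    (hS : S = {L | ∃ (v : X) (κ : Path.Homotopic.Quotient v v), HasLength κ L ∧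
      κ ≠ Path.Homotopic.Quotient.refl v}) (hne : S.Nonempty) : sInf S ∈ S := by
  have hbdd : BddBelow S := ⟨0, by
    rw [hS]
    rintro L ⟨_, _, hL, _⟩
    exact hL.1⟩
  obtain ⟨L, -, hLlim, hLS⟩ := exists_seq_tendsto_sInf hne hbdd
  set l := sInf S with hl
  have hl0 : 0 ≤ l := by
    refine ge_of_tendsto' hLlim fun n => ?_
    have := hLS n
    rw [hS] at this
    obtain ⟨_, _, hL, _⟩ := this
    exact hL.1
  have hex : ∀ n, ∃ (f : C(ℝ, X)) (v : X) (h0 : f 0 = v) (h1 : f 1 = v),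
      (∀ s t, dist (f s) (f t) ≤ L n * |s - t|) ∧
        segClass f 0 1 h0 h1 ≠ Path.Homotopic.Quotient.refl v := by
    intro n
    have := hLS n
    rw [hS] at this
    obtain ⟨v, κ, ⟨hL0, f, hu, hv, hf, rfl⟩, hκ⟩ := this
    refine ⟨f.comp ⟨fun t => t * L n, by fun_prop⟩, v, by simpa using hu, by simpa using hv,
      fun s t => ?_, ?_⟩
    · have := hf (s * L n) (t * L n)
      rw [← sub_mul, abs_mul, abs_of_nonneg hL0] at this
      rw [mul_comm]
      exact this
    · rw [← segClass_congr (f := f) (a := 0) (b := L n) (hu := hu) (hv := hv)]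
      · exact hκ
      · intro t _
        simp
  choose f v h0 h1 hf hnt using hex
  choose g hg using fun s => exists_tendsto_hyperfilter fun n => f n s
  have hL' : Tendsto L (hyperfilter ℕ) (𝓝 l) := hLlim.mono_left Nat.hyperfilter_le_atTop
  have hglip : ∀ s t, dist (g s) (g t) ≤ l * |s - t| := fun s t =>
    le_of_tendsto_of_tendsto' ((hg s).dist (hg t)) (hL'.mul_const _) fun n => hf n s t
  have hgc : Continuous g := by
    refine (LipschitzWith.of_dist_le_mul (K := ⟨l, hl0⟩) fun s t => ?_).continuous
    exact hglip s t
  let G : C(ℝ, X) := ⟨g, hgc⟩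
  have hG : G 1 = g 0 := by
    refine tendsto_nhds_unique (hg 1) ((hg 0).congr fun n => ?_)
    rw [h0, h1]
  have hGnt : segClass G 0 1 rfl hG ≠ Path.Homotopic.Quotient.refl _ := by
    intro hcon
    obtain ⟨N, hN⟩ := exists_nat_gt ((l + 1) / (δ / 4))
    have hN0 : (0 : ℝ) < N := lt_trans (by positivity) hN
    have hev : ∀ᶠ n in (hyperfilter ℕ : Filter ℕ), L n ≤ l + 1 ∧
        ∀ i ∈ Finset.range (N + 1), dist (f n ((i : ℝ) / N)) (g ((i : ℝ) / N)) < δ / 4 := by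
      refine (hL'.eventually_le_const (by linarith)).and ?_
      rw [Filter.eventually_all_finset]
      intro i _
      have := (tendsto_iff_dist_tendsto_zero.1 (hg ((i : ℝ) / N)))
      exact this.eventually_lt_const (by positivity)
    obtain ⟨n, hn1, hn2⟩ := hev.exists
    refine hnt n (segClass_eq_refl_of_close h hδ (K := l + 1) (N := N) (by exact_mod_cast hN0) ?_
      (by linarith) (fun s t => (hf n s t).trans ?_) (fun s t => (hglip s t).trans ?_)
      (fun i hi => hn2 i (by simpa using Nat.lt_succ_of_le hi)) (h0 n) (h1 n) rfl hG hcon)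
    · rw [div_lt_iff₀ hN0]
      rwa [div_lt_iff₀ (by positivity), mul_comm] at hN
    · exact mul_le_mul_of_nonneg_right hn1 (abs_nonneg _)
    · exact mul_le_mul_of_nonneg_right (by linarith) (abs_nonneg _)
  rw [hS]
  rcases hl0.eq_or_lt with hl1 | hl1
  · exfalso
    apply hGnt
    rw [← segClass_self G 0 rfl rfl]
    refine segClass_congr fun t _ => dist_le_zero.1 ?_
    have := hglip (0 + t * (1 - 0)) (0 + t * (0 - 0))
    rwa [← hl1, zero_mul] at this
  · refine ⟨g 0, segClass G 0 1 rfl hG, ⟨hl0, G.comp ⟨fun t => t / l, by fun_prop⟩, by simp [G],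
      by simpa [hl1.ne'] using hG, fun s t => ?_, ?_⟩, hGnt⟩
    · refine (hglip (s / l) (t / l)).trans (le_of_eq ?_)
      rw [← sub_div, abs_div, abs_of_pos hl1]
      field_simp
    · refine segClass_congr fun t _ => ?_
      simp [hl1.ne']

theorem exists_simple_essential_loop [CompactSpace X] (h : IsLengthSpace X) {δ : ℝ}
    (hδ0 : 0 < δ) (hδ : ∀ x : X, RelSimplyConnected (ball x δ)) {u : X}
    {κ : Path.Homotopic.Quotient u u} {L : ℝ} (hL : HasLength κ L)
    (hκ : κ ≠ Path.Homotopic.Quotient.refl u) :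
    ∃ (f : C(ℝ, X)) (v : X) (h0 : f 0 = v) (h1 : f 1 = v),
      (∀ s ∈ Icc (0 : ℝ) 1, ∀ t ∈ Icc (0 : ℝ) 1, dist (f s) (f t) ≤ L) ∧
      InjOn f (Ico 0 1) ∧ segClass f 0 1 h0 h1 ≠ Path.Homotopic.Quotient.refl v := by
  obtain ⟨S, hS⟩ : ∃ S : Set ℝ, S = {L | ∃ (v : X) (κ : Path.Homotopic.Quotient v v),
    HasLength κ L ∧ κ ≠ Path.Homotopic.Quotient.refl v} := ⟨_, rfl⟩
  have hLS : L ∈ S := by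
    rw [hS]
    exact ⟨u, κ, hL, hκ⟩
  have hmem := exists_minimal_essential_length h hδ0 hδ hS ⟨L, hLS⟩
  have hbdd : BddBelow S := ⟨0, by
    rw [hS]
    rintro L ⟨_, _, hL, _⟩
    exact hL.1⟩
  have hmin : ∀ (v : X) (κ : Path.Homotopic.Quotient v v) (M : ℝ), HasLength κ M →
      M < sInf S → κ = Path.Homotopic.Quotient.refl v := by
    intro v κ M hM hlt
    by_contra hne
    exact absurd (csInf_le hbdd (show M ∈ S by rw [hS]; exact ⟨v, κ, hM, hne⟩)) (not_le.2 hlt)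
  have hle : sInf S ≤ L := csInf_le hbdd hLS
  set l := sInf S with hl
  rw [hS] at hmem
  obtain ⟨v, κ', hκ', hnt⟩ := hmem
  obtain ⟨hl0, f, h0, h1, hf, rfl⟩ := id hκ'
  have hlpos : 0 < l := by
    rcases hl0.eq_or_lt with hl1 | hl1
    · exfalso
      have : ∀ (m : ℝ) (hm : m = 0) (h1 : f m = v),
          segClass f 0 m h0 h1 = Path.Homotopic.Quotient.refl v := by
        rintro m rfl h1
        exact segClass_self f 0 h0 h1
      exact hnt (this l hl1.symm h1)
    · exact hl1
  have hinj : ∀ s t : ℝ, 0 ≤ s → s < t → t < l → f s ≠ f t := by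
    intro s t hs hst ht heq
    apply hnt
    have hmid := hmin _ _ _ (HasLength.of_segClass hf hst.le rfl heq.symm) (by linarith)
    rw [← segClass_trans f 0 t l h0 heq.symm h1, ← segClass_trans f 0 s t h0 rfl heq.symm, hmid,
      Path.Homotopic.Quotient.trans_refl]
    refine hmin _ _ _ ((HasLength.of_segClass hf hs h0 rfl).trans
      (HasLength.of_segClass hf ht.le heq.symm h1)) (by linarith)
  refine ⟨f.comp ⟨fun t => t * l, by fun_prop⟩, v, by simpa using h0, by simpa using h1,
    fun s hs t ht => ?_, ?_, ?_⟩
  · refine (hf (s * l) (t * l)).trans (le_trans ?_ hle)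
    rw [← sub_mul, abs_mul, abs_of_pos hlpos]
    have : |s - t| ≤ 1 := abs_le.2 ⟨by linarith [hs.1, ht.2], by linarith [hs.2, ht.1]⟩
    nlinarith
  · intro s hs t ht hst
    simp only [ContinuousMap.comp_apply, ContinuousMap.coe_mk] at hst
    rcases lt_trichotomy s t with hlt | heq | hlt
    · exact absurd hst (hinj _ _ (mul_nonneg hs.1 hl0) (by nlinarith) (by nlinarith [ht.2]))
    · exact heq
    · exact absurd hst.symm (hinj _ _ (mul_nonneg ht.1 hl0) (by nlinarith) (by nlinarith [hs.2]))
  · rw [← segClass_congr (f := f) (a := 0) (b := l) (hu := h0) (hv := h1)]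
    · exact hnt
    · intro t _
      simp

end Systole

/-! ## Circle maps and loops -/

section CircleMaps

variable {X Y : Type*} [TopologicalSpace X] [TopologicalSpace Y]

instance : CompactSpace Circle1 := isCompact_iff_compactSpace.1 (isCompact_sphere _ _)

/-- A curve that runs exactly once around the circle on `[0, 1]`. -/
structure IsCircleParam (e : C(ℝ, Circle1)) : Prop where
  closed : e 0 = e 1
  injOn : InjOn e (Ico 0 1)
  surj : ∀ w, ∃ t ∈ Ico (0 : ℝ) 1, e t = w

theorem exists_isCircleParam (z : Circle1) : ∃ e : C(ℝ, Circle1), IsCircleParam e ∧ e 0 = z := by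
  let ι : ℂ ≃ₗᵢ[ℝ] EuclideanSpace ℝ (Fin 2) := Complex.orthonormalBasisOneI.repr
  have hι : ∀ w : Circle, ι w ∈ Circle1 := fun w => by
    simp [Circle1, Circle.norm_coe]
  have hι' : ∀ w : Circle1, ∃ u : Circle, ι u = w := fun w =>
    ⟨⟨ι.symm w, by
      have := w.2
      simp only [Circle1, mem_sphere_iff_norm, sub_zero] at this
      simp [Submonoid.unitSphere, this]⟩, by simp⟩
  obtain ⟨u, hu⟩ := hι' z
  obtain ⟨θ, rfl⟩ : ∃ θ : ℝ, Circle.exp θ = u := ⟨_, Circle.exp_arg u⟩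
  have hπ := Real.two_pi_pos
  have heq : ∀ s t : ℝ, Circle.exp (θ + 2 * Real.pi * s) = Circle.exp (θ + 2 * Real.pi * t) ↔
      ∃ m : ℤ, s = t + m := by
    intro s t
    rw [Circle.exp_eq_exp]
    refine exists_congr fun m => ⟨fun h => ?_, fun h => ?_⟩
    · apply mul_left_cancel₀ hπ.ne'
      linarith
    · rw [h]
      ring
  let e : C(ℝ, Circle1) :=
    ⟨fun t => ⟨ι (Circle.exp (θ + 2 * Real.pi * t)), hι _⟩, by fun_prop⟩
  have hev : ∀ s t, e s = e t ↔ ∃ m : ℤ, s = t + m := by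
    intro s t
    rw [← heq]
    simp only [e, ContinuousMap.coe_mk, Subtype.ext_iff, ι.injective.eq_iff]
    exact Subtype.ext_iff.symm
  refine ⟨e, ⟨?_, ?_, ?_⟩, ?_⟩
  · exact (hev 0 1).2 ⟨-1, by norm_num⟩
  · intro s hs t ht hst
    obtain ⟨m, hm⟩ := (hev s t).1 hst
    have h1 : (m : ℝ) < 1 := by linarith [hs.2, ht.1]
    have h2 : (-1 : ℝ) < m := by linarith [hs.1, ht.2]
    have h1' : m < 1 := by exact_mod_cast h1
    have h2' : -1 < m := by exact_mod_cast h2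
    obtain rfl : m = 0 := by omega
    simpa using hm
  · intro w
    obtain ⟨u, hu'⟩ := hι' w
    obtain ⟨α, rfl⟩ : ∃ α : ℝ, Circle.exp α = u := ⟨_, Circle.exp_arg u⟩
    refine ⟨Int.fract ((α - θ) / (2 * Real.pi)), ⟨Int.fract_nonneg _, Int.fract_lt_one _⟩, ?_⟩
    trans e ((α - θ) / (2 * Real.pi))
    · refine (hev _ _).2 ⟨-⌊(α - θ) / (2 * Real.pi)⌋, ?_⟩
      have := Int.fract_add_floor ((α - θ) / (2 * Real.pi))
      push_cast
      linarith
    · apply Subtype.ext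
      rw [← hu']
      simp only [e, ContinuousMap.coe_mk]
      congr 3
      field_simp
      ring
  · apply Subtype.ext
    rw [← hu]
    simp [e]

theorem IsCircleParam.exists_descend {e : C(ℝ, Circle1)} (he : IsCircleParam e) {K : Type*}
    [TopologicalSpace K] [CompactSpace K] [T2Space K] (F : C(K × I, X))
    (hF : ∀ k, F (k, 0) = F (k, 1)) :
    ∃ G : C(K × Circle1, X), ∀ k, ∀ t : I, G (k, e t) = F (k, t) := by
  let q : C(K × I, K × Circle1) := ⟨fun p => (p.1, e p.2), by fun_prop⟩
  have hq : IsQuotientMap q := by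
    refine (map_continuous q).isClosedMap.isQuotientMap (map_continuous q) ?_
    rintro ⟨k, w⟩
    obtain ⟨t, ht, rfl⟩ := he.surj w
    exact ⟨(k, ⟨t, ht.1, ht.2.le⟩), rfl⟩
  have key : ∀ k, ∀ s t : I, s < t → e s = e t → F (k, s) = F (k, t) := by
    intro k s t hst h
    have hs1 : (s : ℝ) ∈ Ico (0 : ℝ) 1 := ⟨s.2.1, lt_of_lt_of_le hst t.2.2⟩
    rcases t.2.2.lt_or_eq with ht | ht
    · exact absurd (he.injOn hs1 ⟨t.2.1, ht⟩ h) (ne_of_lt hst)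
    · rw [ht, ← he.closed] at h
      have hs := he.injOn hs1 ⟨le_rfl, zero_lt_one⟩ h
      obtain rfl : s = 0 := Subtype.ext hs
      obtain rfl : t = 1 := Subtype.ext ht
      exact hF k
  have hfac : Function.FactorsThrough F q := by
    rintro ⟨k, s⟩ ⟨k', t⟩ h
    obtain ⟨hk, he'⟩ : k = k' ∧ e s = e t := Prod.ext_iff.1 h
    subst hk
    rcases lt_trichotomy s t with hlt | heq | hlt
    · exact key k s t hlt he'
    · rw [heq]
    · exact (key k t s hlt he'.symm).symm
  exact ⟨hq.lift F hfac, fun k t => DFunLike.congr_fun (hq.lift_comp F hfac) (k, t)⟩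

theorem segClass_comp_eq_refl {g : C(Y, X)} {y : X} (h : g.Homotopic (.const Y y)) (e : C(ℝ, Y))
    (he : e 0 = e 1) {v : X} (h0 : g.comp e 0 = v) (h1 : g.comp e 1 = v) :
    segClass (g.comp e) 0 1 h0 h1 = Path.Homotopic.Quotient.refl v := by
  have h2 : g (e 0) = v := h0
  subst h2
  exact mk_map_eq_of_homotopic_const h (segPath e 0 1 rfl he.symm) (Path.refl (e 0))

theorem isNullhomotopic_of_segClass_eq_refl {e : C(ℝ, Circle1)} (he : IsCircleParam e)
    (g : C(Circle1, X)) {v : X} (h0 : g.comp e 0 = v) (h1 : g.comp e 1 = v)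
    (h : segClass (g.comp e) 0 1 h0 h1 = Path.Homotopic.Quotient.refl v) :
    IsNullhomotopic g := by
  obtain ⟨F⟩ : Path.Homotopic (segPath (g.comp e) 0 1 h0 h1) (Path.refl v) :=
    Path.Homotopic.Quotient.eq.1 h
  obtain ⟨G, hG⟩ := he.exists_descend (F : C(I × I, X)) fun k => by
    exact (Path.Homotopy.source F k).trans (Path.Homotopy.target F k).symm
  refine ⟨v, ⟨⟨G, fun w => ?_, fun w => ?_⟩⟩⟩
  · obtain ⟨t, ht, rfl⟩ := he.surj w
    refine (hG 0 ⟨t, ht.1, ht.2.le⟩).trans ((F.apply_zero _).trans ?_)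
    simp [segPath]
  · obtain ⟨t, ht, rfl⟩ := he.surj w
    exact (hG 1 ⟨t, ht.1, ht.2.le⟩).trans (F.apply_one _)

theorem IsCircleParam.exists_injective {e : C(ℝ, Circle1)} (he : IsCircleParam e) {f : C(ℝ, X)}
    (hf : f 0 = f 1) (hinj : InjOn f (Ico 0 1)) :
    ∃ g : C(Circle1, X), Function.Injective g ∧ range g = f '' Icc 0 1 ∧
      ∀ t ∈ Icc (0 : ℝ) 1, g (e t) = f t := by
  obtain ⟨G, hG⟩ := he.exists_descend (K := Unit) ⟨fun p : Unit × I => f p.2, by fun_prop⟩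
    fun _ => by simpa using hf
  let g : C(Circle1, X) := ⟨fun w => G ((), w), by fun_prop⟩
  have hg : ∀ t ∈ Icc (0 : ℝ) 1, g (e t) = f t := fun t ht => hG () ⟨t, ht⟩
  refine ⟨g, ?_, ?_, hg⟩
  · intro w w' h
    obtain ⟨s, hs, rfl⟩ := he.surj w
    obtain ⟨t, ht, rfl⟩ := he.surj w'
    rw [hg s (Ico_subset_Icc_self hs), hg t (Ico_subset_Icc_self ht)] at h
    rw [hinj hs ht h]
  · ext x
    constructor
    · rintro ⟨w, rfl⟩
      obtain ⟨s, hs, rfl⟩ := he.surj w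
      exact ⟨s, Ico_subset_Icc_self hs, (hg s (Ico_subset_Icc_self hs)).symm⟩
    · rintro ⟨s, hs, rfl⟩
      exact ⟨e s, hg s hs⟩

theorem isNullhomotopic_of_range_eq [T2Space X] {g g' : C(Circle1, X)}
    (hg' : Function.Injective g') (hr : range g' = range g) (h : IsNullhomotopic g') :
    IsNullhomotopic g := by
  have hemb : IsEmbedding g' := (g'.continuous.isClosedEmbedding hg').isEmbedding
  let e := hemb.toHomeomorph
  have hmem : ∀ w, g w ∈ range g' := fun w => hr ▸ mem_range_self w
  let k : C(Circle1, Circle1) :=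
    ⟨fun w => e.symm ⟨g w, hmem w⟩,
      e.symm.continuous.comp (g.continuous.subtype_mk hmem)⟩
  have hk : g'.comp k = g := by
    ext w
    have := e.apply_symm_apply ⟨g w, hmem w⟩
    exact congrArg Subtype.val this
  obtain ⟨y, hy⟩ := h
  refine ⟨y, ?_⟩
  rw [← hk]
  exact hy.comp (ContinuousMap.Homotopic.refl k)

theorem isNonContractibleJordanCurve_image [T2Space X] {f : C(ℝ, X)} {v : X} (h0 : f 0 = v)
    (h1 : f 1 = v) (hinj : InjOn f (Ico 0 1))
    (hf : segClass f 0 1 h0 h1 ≠ Path.Homotopic.Quotient.refl v) :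
    IsNonContractibleJordanCurve (f '' Icc 0 1) := by
  have hz : (EuclideanSpace.single 0 1 : EuclideanSpace ℝ (Fin 2)) ∈ Circle1 := by simp [Circle1]
  obtain ⟨e, he, -⟩ := exists_isCircleParam ⟨_, hz⟩
  obtain ⟨g, hg, hgr, hge⟩ := he.exists_injective (h0.trans h1.symm) hinj
  have hemb : IsEmbedding g := (g.continuous.isClosedEmbedding hg).isEmbedding
  rw [← hgr]
  refine ⟨⟨hemb.toHomeomorph.symm⟩, fun g' hg' hr hnull => hf ?_⟩
  obtain ⟨y, hy⟩ := isNullhomotopic_of_range_eq hg' hr hnull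
  rw [← segClass_comp_eq_refl hy e he.closed ((hge 0 (by simp)).trans h0)
    ((hge 1 (by simp)).trans h1)]
  exact segClass_congr' zero_le_one fun t ht => (hge t ht).symm

theorem mk_eq_mk_of_isContractibleJordanCurve {u v : X} {γ β : Path u v}
    (hγ : Function.Injective γ) (hβ : Function.Injective β)
    (hγβ : ∀ s t, γ s = β t → s = 0 ∨ s = 1)
    (h : IsContractibleJordanCurve (range γ ∪ range β)) :
    Path.Homotopic.Quotient.mk γ = Path.Homotopic.Quotient.mk β := by
  have hz : (EuclideanSpace.single 0 1 : EuclideanSpace ℝ (Fin 2)) ∈ Circle1 := by simp [Circle1]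
  obtain ⟨e, he, -⟩ := exists_isCircleParam ⟨_, hz⟩
  let f : C(ℝ, X) := pathExt (γ.trans β.symm)
  have hf0 : f 0 = u := pathExt_zero _
  have hf1 : f 1 = u := pathExt_one _
  have hrange : f '' Icc 0 1 = range γ ∪ range β := by
    rw [← Path.symm_range β, ← Path.trans_range]
    ext x
    constructor
    · rintro ⟨t, ht, rfl⟩
      exact ⟨⟨t, ht⟩, (pathExt_apply (γ.trans β.symm) ⟨t, ht⟩).symm⟩
    · rintro ⟨t, rfl⟩
      exact ⟨t, t.2, pathExt_apply (γ.trans β.symm) t⟩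
  have hcases : ∀ t ∈ Ico (0 : ℝ) 1,
      (∃ s : I, t = s / 2 ∧ f t = γ s) ∨ (∃ s : I, t = 1 - s / 2 ∧ s ≠ 0 ∧ s ≠ 1 ∧ f t = β s) := by
    intro t ht
    have h1 : f t = (γ.trans β.symm) ⟨t, ht.1, ht.2.le⟩ :=
      pathExt_apply (γ.trans β.symm) ⟨t, ht.1, ht.2.le⟩
    rw [Path.trans_apply] at h1
    by_cases hle : t ≤ 1 / 2
    · rw [dif_pos hle] at h1
      exact Or.inl ⟨⟨2 * t, by linarith [ht.1], by linarith⟩, by simp, h1⟩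
    · rw [dif_neg hle] at h1
      push Not at hle
      refine Or.inr ⟨⟨2 - 2 * t, by linarith [ht.2], by linarith⟩, ?_, ?_, ?_, ?_⟩
      · simp
        ring
      · intro h0
        have := congrArg Subtype.val h0
        simp at this
        linarith [ht.2]
      · intro h0
        have := congrArg Subtype.val h0
        simp at this
        linarith
      · refine h1.trans (congrArg β ?_)
        apply Subtype.ext
        simp
        ring
  have hcross : ∀ s t : I, t ≠ 0 → t ≠ 1 → γ s ≠ β t := by
    intro s t ht0 ht1 hst
    rcases hγβ s t hst with rfl | rfl
    · exact ht0 (hβ (by rw [← hst, γ.source, β.source]))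
    · exact ht1 (hβ (by rw [← hst, γ.target, β.target]))
  have hinj : InjOn f (Ico 0 1) := by
    intro s hs t ht hst
    rcases hcases s hs with ⟨s', hs', hfs⟩ | ⟨s', hs', hs0, hs1, hfs⟩ <;>
    rcases hcases t ht with ⟨t', ht', hft⟩ | ⟨t', ht', ht0, ht1, hft⟩ <;>
    rw [hfs, hft] at hst
    · rw [hs', ht', hγ hst]
    · exact absurd hst (hcross _ _ ht0 ht1)
    · exact absurd hst.symm (hcross _ _ hs0 hs1)
    · rw [hs', ht', hβ hst]
  obtain ⟨g, hg, hgr, hge⟩ := he.exists_injective (hf0.trans hf1.symm) hinj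
  obtain ⟨y, hy⟩ := h.2 g hg (hgr.trans hrange)
  have h1 : segClass f 0 1 hf0 hf1 = Path.Homotopic.Quotient.refl u := by
    rw [← segClass_comp_eq_refl hy e he.closed ((hge 0 (by simp)).trans hf0)
      ((hge 1 (by simp)).trans hf1)]
    exact segClass_congr' zero_le_one fun t ht => (hge t ht).symm
  rw [segClass_pathExt, Path.Homotopic.Quotient.mk_trans, Path.Homotopic.Quotient.mk_symm] at h1
  apply pclass_trans_right_cancel (τ := (Path.Homotopic.Quotient.mk β).symm)
  rw [h1, Path.Homotopic.Quotient.trans_symm]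

end CircleMaps

/-! ## Charts of surfaces -/

section Charts

variable {X : Type*} [TopologicalSpace X]

theorem exists_openPartialHomeomorph {Y : Type*} [TopologicalSpace Y] {U : Set X} {V : Set Y}
    (hU : IsOpen U) (hV : IsOpen V) (e : U ≃ₜ V) {x : X} (hx : x ∈ U) :
    ∃ e : OpenPartialHomeomorph X Y, x ∈ e.source := by
  have : Nonempty U := ⟨⟨x, hx⟩⟩
  have : Nonempty V := ⟨e ⟨x, hx⟩⟩
  refine ⟨(hU.isOpenEmbedding_subtypeVal.toOpenPartialHomeomorph Subtype.val).symm.trans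
    (e.toOpenPartialHomeomorph.trans
      (hV.isOpenEmbedding_subtypeVal.toOpenPartialHomeomorph Subtype.val)), ?_⟩
  simp [hx]

theorem notMem_surfaceBoundary_iff {x : X} :
    x ∉ surfaceBoundary X ↔ ∃ e : OpenPartialHomeomorph X (ℝ × ℝ), x ∈ e.source := by
  simp only [surfaceBoundary, mem_ofPred_eq, not_not]
  constructor
  · rintro ⟨U, V, hU, hx, hV, ⟨e⟩⟩
    exact exists_openPartialHomeomorph hU hV e hx
  · rintro ⟨e, hx⟩
    exact ⟨e.source, e.target, e.open_source, hx, e.open_target, ⟨e.toHomeomorphSourceTarget⟩⟩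

theorem isClosed_surfaceBoundary : IsClosed (surfaceBoundary X) := by
  rw [← isOpen_compl_iff, isOpen_iff_forall_mem_open]
  intro x hx
  obtain ⟨e, he⟩ := notMem_surfaceBoundary_iff.1 hx
  exact ⟨e.source, fun y hy => notMem_surfaceBoundary_iff.2 ⟨e, hy⟩, e.open_source, he⟩

theorem IsSurface.exists_chart (h : IsSurface X) (x : X) :
    ∃ e : OpenPartialHomeomorph X HalfPlane, x ∈ e.source := by
  obtain ⟨U, V, hU, hx, hV, ⟨e⟩⟩ := h x
  exact exists_openPartialHomeomorph hU hV e hx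

/-- The inclusion of the open half plane into the plane. -/
def openHalfPlaneChart : OpenPartialHomeomorph HalfPlane (ℝ × ℝ) where
  toFun p := p
  invFun p := ⟨(p.1, max p.2 0), (le_max_right _ _ : (0 : ℝ) ≤ max p.2 0)⟩
  source := {p | 0 < (p : ℝ × ℝ).2}
  target := {p | 0 < p.2}
  map_source' _ hp := hp
  map_target' p hp := by
    have : 0 < p.2 := hp
    simp [this]
  left_inv' p hp := by
    have : 0 < (p : ℝ × ℝ).2 := hp
    apply Subtype.ext
    simp [this.le]
  right_inv' p hp := by
    have : 0 < p.2 := hp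
    simp [this.le]
  open_source := isOpen_lt continuous_const (by fun_prop)
  open_target := isOpen_lt continuous_const (by fun_prop)
  continuousOn_toFun := by fun_prop
  continuousOn_invFun := (Continuous.subtype_mk (by fun_prop) _).continuousOn

/-- Horizontal translation of the half plane. -/
def halfPlaneTranslate (a : ℝ) : HalfPlane ≃ₜ HalfPlane where
  toFun p := ⟨((p : ℝ × ℝ).1 + a, (p : ℝ × ℝ).2), p.2⟩
  invFun p := ⟨((p : ℝ × ℝ).1 - a, (p : ℝ × ℝ).2), p.2⟩
  left_inv p := by simp
  right_inv p := by simp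
  continuous_toFun := by fun_prop
  continuous_invFun := by fun_prop

theorem notMem_surfaceBoundary_of_pos (e : OpenPartialHomeomorph X HalfPlane) {x : X}
    (hx : x ∈ e.source) (h : 0 < (e x : ℝ × ℝ).2) : x ∉ surfaceBoundary X :=
  notMem_surfaceBoundary_iff.2 ⟨e.trans openHalfPlaneChart, by
    rw [OpenPartialHomeomorph.trans_source]
    exact ⟨hx, h⟩⟩

theorem snd_eq_zero_of_mem_surfaceBoundary (e : OpenPartialHomeomorph X HalfPlane) {x : X}
    (hx : x ∈ e.source) (h : x ∈ surfaceBoundary X) : (e x : ℝ × ℝ).2 = 0 :=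
  ((e x).2.eq_or_lt.resolve_right fun h' => notMem_surfaceBoundary_of_pos e hx h' h).symm

theorem mem_surfaceBoundary_iff (e : OpenPartialHomeomorph X HalfPlane) {x y : X}
    (hx : x ∈ e.source) (hxB : x ∈ surfaceBoundary X) (hy : y ∈ e.source) :
    y ∈ surfaceBoundary X ↔ (e y : ℝ × ℝ).2 = 0 := by
  refine ⟨snd_eq_zero_of_mem_surfaceBoundary e hy, fun hy0 => ?_⟩
  by_contra hyB
  obtain ⟨e', hye'⟩ := notMem_surfaceBoundary_iff.1 hyB
  have hx0 := snd_eq_zero_of_mem_surfaceBoundary e hx hxB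
  let τ := halfPlaneTranslate ((e y : ℝ × ℝ).1 - (e x : ℝ × ℝ).1)
  have hτ : τ (e x) = e y := by
    apply Subtype.ext
    simp [τ, halfPlaneTranslate, Prod.ext_iff, hx0, hy0]
  refine notMem_surfaceBoundary_iff.2
    ⟨e.trans (τ.toOpenPartialHomeomorph.trans (e.symm.trans e')), ?_⟩ hxB
  simp [hx, hτ, hy, hye']

theorem IsSurface.exists_adapted_chart (h : IsSurface X) (x : X) :
    ∃ e : OpenPartialHomeomorph X HalfPlane, x ∈ e.source ∧
      ((∀ y ∈ e.source, y ∉ surfaceBoundary X) ∨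
        ((e x : ℝ × ℝ).2 = 0 ∧ ∀ y ∈ e.source, y ∈ surfaceBoundary X ↔ (e y : ℝ × ℝ).2 = 0)) := by
  obtain ⟨e, hx⟩ := h.exists_chart x
  by_cases hxB : x ∈ surfaceBoundary X
  · exact ⟨e, hx, Or.inr ⟨snd_eq_zero_of_mem_surfaceBoundary e hx hxB,
      fun y hy => mem_surfaceBoundary_iff e hx hxB hy⟩⟩
  · refine ⟨e.restrOpen _ isClosed_surfaceBoundary.isOpen_compl, ?_, Or.inl fun y hy => ?_⟩
    · rw [OpenPartialHomeomorph.restrOpen_source]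
      exact ⟨hx, hxB⟩
    · rw [OpenPartialHomeomorph.restrOpen_source] at hy
      exact hy.2

theorem convex_halfPlane : Convex ℝ HalfPlane := by
  intro p hp q hq a b ha hb _
  simp only [HalfPlane, mem_ofPred_eq, Prod.snd_add, Prod.smul_snd, smul_eq_mul] at *
  positivity

theorem IsSurface.exists_contraction (h : IsSurface X) (x : X) :
    ∃ (U : Set X) (hx : x ∈ U) (c : C(I × U, U)), IsOpen U ∧ (∀ y, c (0, y) = y) ∧
      (∀ y, c (1, y) = ⟨x, hx⟩) ∧
      ∀ s, ∀ y : U, (y : X) ∈ surfaceBoundary X → (c (s, y) : X) ∈ surfaceBoundary X := by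
  obtain ⟨e, hx, he⟩ := h.exists_adapted_chart x
  obtain ⟨r, hr, hball⟩ := Metric.isOpen_iff.1 e.open_target (e x) (e.map_source hx)
  let U : Set X := e.source ∩ e ⁻¹' ball (e x) r
  have hxU : x ∈ U := ⟨hx, mem_ball_self hr⟩
  let k : I × U → HalfPlane := fun p =>
    ⟨(1 - (p.1 : ℝ)) • (e p.2 : ℝ × ℝ) + (p.1 : ℝ) • (e x : ℝ × ℝ),
      convex_halfPlane (e p.2).2 (e x).2 (by linarith [p.1.2.2]) p.1.2.1 (by ring)⟩
  have hk : ∀ p, k p ∈ ball (e x) r := by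
    rintro ⟨s, y⟩
    have h1 : (e y : ℝ × ℝ) ∈ ball (e x : ℝ × ℝ) r := y.2.2
    have := convex_ball (e x : ℝ × ℝ) r h1 (mem_ball_self hr)
      (by linarith [s.2.2] : 0 ≤ 1 - (s : ℝ)) s.2.1 (by ring)
    exact this
  have hec : Continuous fun y : U => e y :=
    e.continuousOn.comp_continuous continuous_subtype_val fun y => y.2.1
  have hkc : Continuous k := by
    refine Continuous.subtype_mk ?_ _
    have : Continuous fun p : I × U => (e p.2 : ℝ × ℝ) :=
      continuous_subtype_val.comp (hec.comp continuous_snd)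
    fun_prop
  have hmem : ∀ p, e.symm (k p) ∈ U := fun p =>
    ⟨e.map_target (hball (hk p)), by
      rw [mem_preimage, e.right_inv (hball (hk p))]
      exact hk p⟩
  refine ⟨U, hxU, ⟨fun p => ⟨e.symm (k p), hmem p⟩, ?_⟩,
    e.continuousOn.isOpen_inter_preimage e.open_source isOpen_ball, ?_, ?_, ?_⟩
  · exact (e.symm.continuousOn.comp_continuous hkc fun p => hball (hk p)).subtype_mk _
  · intro y
    apply Subtype.ext
    have : k (0, y) = e y := Subtype.ext (by simp [k])
    simp only [ContinuousMap.coe_mk, this]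
    exact e.left_inv y.2.1
  · intro y
    apply Subtype.ext
    have : k (1, y) = e x := Subtype.ext (by simp [k])
    simp only [ContinuousMap.coe_mk, this]
    exact e.left_inv hx
  · intro s y hy
    rcases he with he | ⟨hx0, he⟩
    · exact absurd hy (he y y.2.1)
    · refine (he _ (hmem (s, y)).1).2 ?_
      rw [e.right_inv (hball (hk (s, y)))]
      have := (he y y.2.1).1 hy
      simp [k, this, hx0]

theorem IsSurface.exists_relSimplyConnected (h : IsSurface X) (x : X) :
    ∃ U : Set X, IsOpen U ∧ x ∈ U ∧ RelSimplyConnected U := by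
  obtain ⟨U, hx, c, hU, h0, h1, -⟩ := h.exists_contraction x
  refine ⟨U, hU, hx, relSimplyConnected_of_homotopic_const (y := x)
    ⟨⟨⟨fun p => c p, by fun_prop⟩, fun y => ?_, fun y => ?_⟩⟩⟩
  · simp [h0]
  · simp [h1]

theorem IsSurface.exists_uniform_relSimplyConnected {X : Type*} [MetricSpace X] [CompactSpace X]
    (h : IsSurface X) : ∃ δ > 0, ∀ x : X, RelSimplyConnected (ball x δ) := by
  choose U hU hx hs using h.exists_relSimplyConnected
  obtain ⟨δ, hδ, hcov⟩ := lebesgue_number_lemma_of_metric isCompact_univ hU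
    fun x _ => mem_iUnion.2 ⟨x, hx x⟩
  refine ⟨δ, hδ, fun x => ?_⟩
  obtain ⟨i, hi⟩ := hcov x (mem_univ x)
  exact (hs i).mono hi

end Charts

section PushOff

variable {X : Type*} [MetricSpace X]

/-- Pushing the half plane upwards in the ball of radius `r` around `p`. -/
def halfPlanePush (p : HalfPlane) (r : ℝ) (a : I) (q : HalfPlane) : HalfPlane :=
  ⟨((q : ℝ × ℝ).1, (q : ℝ × ℝ).2 + a * max 0 (r - dist q p)), by
    have h1 : 0 ≤ (q : ℝ × ℝ).2 := q.2
    have h2 : 0 ≤ (a : ℝ) := a.2.1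
    change 0 ≤ (q : ℝ × ℝ).2 + a * max 0 (r - dist q p)
    positivity⟩

theorem continuous_halfPlanePush (p : HalfPlane) (r : ℝ) :
    Continuous fun x : I × HalfPlane => halfPlanePush p r x.1 x.2 := by
  unfold halfPlanePush
  fun_prop

theorem halfPlanePush_zero (p : HalfPlane) (r : ℝ) (q : HalfPlane) :
    halfPlanePush p r 0 q = q := by
  apply Subtype.ext
  simp [halfPlanePush]

theorem halfPlanePush_of_le (p : HalfPlane) {r : ℝ} (a : I) {q : HalfPlane} (h : r ≤ dist q p) :
    halfPlanePush p r a q = q := by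
  apply Subtype.ext
  simp [halfPlanePush, h]

theorem halfPlanePush_injective (p : HalfPlane) (r : ℝ) {a : I} (ha : a < 1) :
    Function.Injective (halfPlanePush p r a) := by
  intro q q' h
  have h1 := congrArg Subtype.val h
  simp only [halfPlanePush, Prod.mk.injEq] at h1
  obtain ⟨h1, h2⟩ := h1
  have h3 : |max 0 (r - dist q p) - max 0 (r - dist q' p)| ≤ dist q q' := by
    rw [max_comm 0, max_comm 0]
    refine (abs_max_sub_max_le_abs _ _ _).trans ?_
    rw [show r - dist q p - (r - dist q' p) = dist q' p - dist q p by ring, dist_comm q q']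
    exact abs_dist_sub_le _ _ _
  have h4 : dist q q' = |(q : ℝ × ℝ).2 - (q' : ℝ × ℝ).2| := by
    rw [Subtype.dist_eq, Prod.dist_eq, h1, dist_self, Real.dist_eq]
    exact max_eq_right (abs_nonneg _)
  have ha' : (a : ℝ) < 1 := ha
  have h5 : |(q : ℝ × ℝ).2 - (q' : ℝ × ℝ).2| =
      a * |max 0 (r - dist q p) - max 0 (r - dist q' p)| := by
    rw [show (q : ℝ × ℝ).2 - (q' : ℝ × ℝ).2 =
        -(a * (max 0 (r - dist q p) - max 0 (r - dist q' p))) by linarith,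
      abs_neg, abs_mul, abs_of_nonneg a.2.1]
  have h6 : dist q q' ≤ a * dist q q' := by
    refine (h4.trans h5).le.trans ?_
    exact mul_le_mul_of_nonneg_left h3 a.2.1
  refine dist_le_zero.1 ?_
  nlinarith [dist_nonneg (x := q) (y := q')]

theorem halfPlanePush_mem_closedBall {p : HalfPlane} {r : ℝ} (a : I) {q : HalfPlane}
    (h : q ∈ closedBall p r) : halfPlanePush p r a q ∈ closedBall p r := by
  rw [mem_closedBall] at h
  have h1 : dist (q : ℝ × ℝ) p ≤ r := h
  rw [Prod.dist_eq, max_le_iff] at h1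
  have h2 : dist (q : ℝ × ℝ).2 (p : ℝ × ℝ).2 ≤ dist q p := le_max_right _ _
  change dist ((q : ℝ × ℝ).1, (q : ℝ × ℝ).2 + a * max 0 (r - dist q p)) (p : ℝ × ℝ) ≤ r
  rw [Prod.dist_eq]
  refine max_le h1.1 ?_
  rw [max_eq_right (by linarith)]
  simp only [Real.dist_eq] at h2 ⊢
  have h3 : (q : ℝ × ℝ).2 + a * (r - dist q p) - (p : ℝ × ℝ).2 =
    ((q : ℝ × ℝ).2 - (p : ℝ × ℝ).2) + a * (r - dist q p) := by ring
  rw [h3]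
  refine (abs_add_le _ _).trans ?_
  rw [abs_of_nonneg (mul_nonneg a.2.1 (by linarith : 0 ≤ r - dist q p))]
  nlinarith [a.2.2]

theorem snd_halfPlanePush_pos {p : HalfPlane} {r : ℝ} {a : I} (ha : 0 < a) {q : HalfPlane}
    (h : dist q p < r) : 0 < (halfPlanePush p r a q : ℝ × ℝ).2 := by
  have h1 : 0 ≤ (q : ℝ × ℝ).2 := q.2
  have h2 : 0 < (a : ℝ) * max 0 (r - dist q p) :=
    mul_pos ha (lt_max_of_lt_right (by linarith))
  simp only [halfPlanePush]
  linarith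

theorem IsSurface.exists_local_push (h : IsSurface X) {x : X} (hxB : x ∈ surfaceBoundary X) :
    ∃ (W : Set X) (H : C(I × X, X)), IsOpen W ∧ x ∈ W ∧ (∀ y, H (0, y) = y) ∧
      ∀ a : I, 0 < a → a < 1 → (Function.Injective fun y => H (a, y)) ∧
        (∀ y, H (a, y) ∈ surfaceBoundary X → H (a, y) = y) ∧
        ∀ y ∈ W, H (a, y) ∉ surfaceBoundary X := by
  classical
  obtain ⟨e, hx, he⟩ := h.exists_adapted_chart x
  obtain ⟨hx0, he⟩ := he.resolve_left fun h' => h' x hx hxB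
  obtain ⟨r, hr, hball⟩ :=
    Metric.nhds_basis_closedBall.mem_iff.1 (e.open_target.mem_nhds (e.map_source hx))
  have hHP : IsClosed HalfPlane := isClosed_le continuous_const continuous_snd
  have : ProperSpace HalfPlane := ProperSpace.of_isClosed hHP
  let K : Set X := e.source ∩ e ⁻¹' closedBall (e x) r
  let W : Set X := e.source ∩ e ⁻¹' ball (e x) r
  have hWo : IsOpen W := e.continuousOn.isOpen_inter_preimage e.open_source isOpen_ball
  have hWK : W ⊆ K := inter_subset_inter_right _ (preimage_mono ball_subset_closedBall)
  have hKc : IsClosed K := by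
    have : K = e.symm '' closedBall (e x) r := by
      rw [e.symm.image_eq_target_inter_inv_preimage hball]
      rfl
    rw [this]
    exact ((isCompact_closedBall _ _).image_of_continuousOn
      (e.symm.continuousOn.mono hball)).isClosed
  let P : I × X → X := fun y => e.symm (halfPlanePush (e x) r y.1 (e y.2))
  have hPt : ∀ a, ∀ y ∈ K, halfPlanePush (e x) r a (e y) ∈ e.target := fun a y hy =>
    hball (halfPlanePush_mem_closedBall a hy.2)
  have heP : ∀ a, ∀ y ∈ K, e (P (a, y)) = halfPlanePush (e x) r a (e y) := fun a y hy =>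
    e.right_inv (hPt a y hy)
  have hPK : ∀ a, ∀ y ∈ K, P (a, y) ∈ K := fun a y hy =>
    ⟨e.map_target (hPt a y hy), by
      rw [mem_preimage, heP a y hy]
      exact halfPlanePush_mem_closedBall a hy.2⟩
  have hPid : ∀ a, ∀ y ∈ K, y ∉ W → P (a, y) = y := by
    intro a y hy hyW
    have : r ≤ dist (e y) (e x) := not_lt.1 fun hlt => hyW ⟨hy.1, hlt⟩
    simp only [P, halfPlanePush_of_le (e x) a this]
    exact e.left_inv hy.1
  have hPc : ContinuousOn P (univ ×ˢ K) := by
    refine e.symm.continuousOn.comp (t := e.target) ?_ fun y hy => hPt y.1 y.2 hy.2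
    refine (continuous_halfPlanePush (e x) r).comp_continuousOn
      (f := fun y : I × X => (y.1, e y.2)) ?_
    refine continuousOn_fst.prodMk (e.continuousOn.comp continuousOn_snd fun y hy => hy.2.1)
  let F : I × X → X := fun y => if y.2 ∈ W then P y else y.2
  have hFK : ∀ a, ∀ y ∈ K, F (a, y) = P (a, y) := by
    intro a y hy
    by_cases hyW : y ∈ W
    · simp [F, hyW]
    · simp [F, hyW, hPid a y hy hyW]
  have hFW : ∀ a, ∀ y ∉ W, F (a, y) = y := fun a y hy => by simp [F, hy]
  have hFc : Continuous F := by
    have h1 : ContinuousOn F (univ ×ˢ K) := hPc.congr fun y hy => hFK y.1 y.2 hy.2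
    have h2 : ContinuousOn F (univ ×ˢ Wᶜ) :=
      continuousOn_snd.congr fun y hy => hFW y.1 y.2 hy.2
    have h3 := h1.union_of_isClosed h2 (isClosed_univ.prod hKc)
      (isClosed_univ.prod hWo.isClosed_compl)
    have h4 : K ∪ Wᶜ = univ := eq_univ_of_forall fun y => by
      by_cases hy : y ∈ W
      · exact Or.inl (hWK hy)
      · exact Or.inr hy
    rw [← prod_union, h4, univ_prod_univ] at h3
    exact continuousOn_univ.1 h3
  refine ⟨W, ⟨F, hFc⟩, hWo, ⟨hx, mem_ball_self hr⟩, fun y => ?_, fun a ha0 ha1 => ⟨?_, ?_, ?_⟩⟩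
  · by_cases hy : y ∈ W
    · refine (hFK 0 y (hWK hy)).trans ?_
      simp only [P, halfPlanePush_zero]
      exact e.left_inv hy.1
    · exact hFW 0 y hy
  · have hKK : ∀ y y', y ∈ K → y' ∈ K → F (a, y) = F (a, y') → y = y' := by
      intro y y' hy hy' hyy
      rw [hFK a y hy, hFK a y' hy'] at hyy
      have := congrArg e hyy
      rw [heP a y hy, heP a y' hy'] at this
      exact e.injOn hy.1 hy'.1 (halfPlanePush_injective _ _ ha1 this)
    have hKn : ∀ y y', y ∈ K → y' ∉ K → F (a, y) ≠ F (a, y') := by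
      intro y y' hy hy' hyy
      rw [hFK a y hy, hFW a y' fun h' => hy' (hWK h')] at hyy
      exact hy' (hyy ▸ hPK a y hy)
    intro y y' hyy
    by_cases hy : y ∈ K <;> by_cases hy' : y' ∈ K
    · exact hKK y y' hy hy' hyy
    · exact absurd hyy (hKn y y' hy hy')
    · exact absurd hyy.symm (hKn y' y hy' hy)
    · have := hFW a y fun h' => hy (hWK h')
      rw [← this, ← hFW a y' fun h' => hy' (hWK h')]
      exact hyy
  · intro y hyB
    by_cases hy : y ∈ W
    · exfalso
      have h1 : F (a, y) = P (a, y) := hFK a y (hWK hy)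
      change F (a, y) ∈ _ at hyB
      rw [h1, he _ (hPK a y (hWK hy)).1, heP a y (hWK hy)] at hyB
      exact (snd_halfPlanePush_pos ha0 hy.2).ne' hyB
    · exact hFW a y hy
  · intro y hy hyB
    change F (a, y) ∈ _ at hyB
    rw [hFK a y (hWK hy), he _ (hPK a y (hWK hy)).1, heP a y (hWK hy)] at hyB
    exact (snd_halfPlanePush_pos ha0 hy.2).ne' hyB

theorem IsSurface.exists_push [CompactSpace X] (h : IsSurface X) {η : ℝ} (hη : 0 < η) :
    ∃ k : C(X, X), Function.Injective k ∧ k.Homotopic (ContinuousMap.id X) ∧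
      (∀ y, dist (k y) y < η) ∧ ∀ y, k y ∉ surfaceBoundary X := by
  suffices H : ∀ η > 0, ∃ k : C(X, X), Function.Injective k ∧ k.Homotopic (ContinuousMap.id X) ∧
      (∀ y, dist (k y) y < η) ∧ (∀ y, k y ∈ surfaceBoundary X → k y = y) ∧
      ∀ y ∈ surfaceBoundary X, k y ∉ surfaceBoundary X by
    obtain ⟨k, h1, h2, h3, h4, h5⟩ := H η hη
    exact ⟨k, h1, h2, h3, fun y hy => h5 y (h4 y hy ▸ hy) hy⟩
  refine isClosed_surfaceBoundary.isCompact.induction_on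
    (p := fun s => ∀ η > 0, ∃ k : C(X, X), Function.Injective k ∧
      k.Homotopic (ContinuousMap.id X) ∧ (∀ y, dist (k y) y < η) ∧
      (∀ y, k y ∈ surfaceBoundary X → k y = y) ∧ ∀ y ∈ s, k y ∉ surfaceBoundary X) ?_ ?_ ?_ ?_
  · intro η hη
    exact ⟨ContinuousMap.id X, fun _ _ h => h, .refl _, fun y => by simpa using hη,
      fun y _ => rfl, fun y hy => absurd hy (notMem_empty y)⟩
  · intro s t hst ht η hη
    obtain ⟨k, h1, h2, h3, h4, h5⟩ := ht η hη
    exact ⟨k, h1, h2, h3, h4, fun y hy => h5 y (hst hy)⟩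
  · intro s t hs ht η hη
    obtain ⟨k, h1, h2, h3, h4, h5⟩ := hs (η / 2) (half_pos hη)
    obtain ⟨k', h1', h2', h3', h4', h5'⟩ := ht (η / 2) (half_pos hη)
    refine ⟨k'.comp k, h1'.comp h1, h2'.comp h2, fun y => ?_, fun y hy => ?_, fun y hy hyB => ?_⟩
    · have a1 := h3 y
      have a2 := h3' (k y)
      have a3 := dist_triangle (k' (k y)) (k y) y
      simp only [ContinuousMap.comp_apply]
      linarith
    · have a1 : k' (k y) = k y := h4' _ hy
      have a2 : k y = y := h4 y (a1 ▸ hy)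
      exact a1.trans a2
    · have a1 : k' (k y) = k y := h4' _ hyB
      have a2 : k y = y := h4 y (a1 ▸ hyB)
      rcases hy with hy | hy
      · exact h5 y hy (a1 ▸ hyB)
      · rw [ContinuousMap.comp_apply, a2] at hyB
        exact h5' y hy hyB
  · intro x hx
    obtain ⟨W, H, hW, hxW, h0, hH⟩ := h.exists_local_push hx
    refine ⟨W, mem_nhdsWithin_of_mem_nhds (hW.mem_nhds hxW), fun η hη => ?_⟩
    obtain ⟨ρ, hρ, huc⟩ := Metric.uniformContinuous_iff.1
      (CompactSpace.uniformContinuous_of_continuous H.continuous) η hη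
    let a : I := ⟨min (1 / 2) (ρ / 2), by positivity, (min_le_left _ _).trans (by norm_num)⟩
    have ha0 : 0 < a := by
      change (0 : ℝ) < min (1 / 2) (ρ / 2)
      positivity
    have ha1 : a < 1 := by
      change min (1 / 2) (ρ / 2) < (1 : ℝ)
      exact (min_le_left _ _).trans_lt (by norm_num)
    obtain ⟨h1, h2, h3⟩ := hH a ha0 ha1
    refine ⟨⟨fun y => H (a, y), by fun_prop⟩, h1, ?_, fun y => ?_, h2, h3⟩
    · refine ContinuousMap.Homotopic.symm ⟨⟨⟨fun p => H (a * p.1, p.2), by fun_prop⟩, ?_, ?_⟩⟩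
      · intro y
        simp [h0]
      · intro y
        simp
    · have : dist (a, y) ((0 : I), y) < ρ := by
        rw [Prod.dist_eq, dist_self, max_eq_left dist_nonneg, Subtype.dist_eq, Real.dist_eq]
        change |min (1 / 2) (ρ / 2) - 0| < ρ
        rw [sub_zero, abs_of_pos (by positivity)]
        exact (min_le_right _ _).trans_lt (by linarith)
      have := huc this
      rwa [h0] at this

end PushOff

/-! ## Curves in the metric double -/

theorem gap_induction {C : Set ℝ} (hC : IsClosed C) (hC1 : C ⊆ Icc 0 1) (h0 : (0 : ℝ) ∈ C)
    (h1 : (1 : ℝ) ∈ C) {Q : ℝ → ℝ → Prop} (hrefl : Q 0 0)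
    (htrans : ∀ t ∈ C, ∀ u, Q 0 t → Q t u → Q 0 u)
    (hloc : ∀ t ∈ C, ∃ ε > 0, ∀ s ∈ C, |s - t| < ε → Q s t ∧ Q t s)
    (hgap : ∀ a ∈ C, ∀ b ∈ C, a < b → (∀ t ∈ Ioo a b, t ∉ C) → Q a b) : Q 0 1 := by
  let S : Set ℝ := {t | t ∈ C ∧ Q 0 t}
  have hSne : S.Nonempty := ⟨0, h0, hrefl⟩
  have hSb : BddAbove S := ⟨1, fun t ht => (hC1 ht.1).2⟩
  obtain ⟨T, hT⟩ : ∃ T, T = sSup S := ⟨_, rfl⟩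
  have hTC : T ∈ C := by
    rw [hT]
    exact hC.closure_subset_iff.2 (fun t ht => ht.1) (csSup_mem_closure hSne hSb)
  obtain ⟨ε, hε, hloc⟩ := hloc T hTC
  have hTS : Q 0 T := by
    obtain ⟨s, hs, hsT⟩ := exists_lt_of_lt_csSup hSne (show T - ε < sSup S by linarith)
    have : s ≤ T := hT ▸ le_csSup hSb hs
    exact htrans s hs.1 T hs.2 (hloc s hs.1 (abs_lt.2 ⟨by linarith, by linarith⟩)).1
  have hmax : ∀ t ∈ C, T < t → ¬ Q T t := fun t ht hlt hQ =>
    absurd (hT ▸ le_csSup hSb ⟨ht, htrans T hTC t hTS hQ⟩) (not_le.2 hlt)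
  rcases (hC1 hTC).2.eq_or_lt with rfl | hT1
  · exact hTS
  exfalso
  let A : Set ℝ := C ∩ Ioi T
  have hAne : A.Nonempty := ⟨1, h1, hT1⟩
  have hAb : BddBelow A := ⟨T, fun t ht => le_of_lt ht.2⟩
  obtain ⟨b, hb⟩ : ∃ b, b = sInf A := ⟨_, rfl⟩
  have hTb : T ≤ b := hb ▸ le_csInf hAne fun t ht => le_of_lt ht.2
  rcases hTb.eq_or_lt with rfl | hTb
  · obtain ⟨s, hs, hsT⟩ := exists_lt_of_csInf_lt hAne (show sInf A < T + ε by linarith)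
    have hs2 : T < s := hs.2
    exact hmax s hs.1 hs2 (hloc s hs.1 (abs_lt.2 ⟨by linarith, by linarith⟩)).2
  · have hbC : b ∈ C := by
      rw [hb]
      exact hC.closure_subset_iff.2 inter_subset_left (csInf_mem_closure hAne hAb)
    refine hmax b hbC hTb (hgap T hTC b hbC hTb fun t ht htC => ?_)
    exact absurd (csInf_le hAb ⟨htC, ht.1⟩) (not_le.2 (hb ▸ ht.2))

section Double

variable {X D : Type*} [MetricSpace X] [MetricSpace D] {B : Set X} {ip im : X → D}

theorem IsMetricDouble.eq_of_ip_eq_im (h : IsMetricDouble X B D ip im) (hB : IsClosed B)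
    (hne : B.Nonempty) {x y : X} (hxy : ip x = im y) : x = y ∧ x ∈ B := by
  have : Nonempty B := hne.to_subtype
  have h0 : ⨅ z : B, (dist x (z : X) + dist (z : X) y) = 0 := by
    rw [← h.dist_mix, hxy, dist_self]
  have hlt : ∀ ε > 0, ∃ z : B, dist x z + dist (z : X) y < ε := fun ε hε =>
    exists_lt_of_ciInf_lt (by rwa [h0])
  constructor
  · refine dist_le_zero.1 (le_of_forall_pos_le_add fun ε hε => ?_)
    obtain ⟨z, hz⟩ := hlt ε hε
    linarith [dist_triangle x z y]
  · rw [← hB.closure_eq]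
    refine Metric.mem_closure_iff.2 fun ε hε => ?_
    obtain ⟨z, hz⟩ := hlt ε hε
    exact ⟨z, z.2, by linarith [dist_nonneg (x := (z : X)) (y := y)]⟩

theorem IsMetricDouble.mem_range_or (h : IsMetricDouble X B D ip im) (d : D) :
    d ∈ range ip ∨ d ∈ range im := by
  have : d ∈ range ip ∪ range im := by
    rw [h.surj]
    trivial
  exact this

theorem IsMetricDouble.dist_le_dist_mix (h : IsMetricDouble X B D ip im) (hne : B.Nonempty)
    (x y : X) : dist x y ≤ dist (ip x) (im y) := by
  have : Nonempty B := hne.to_subtype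
  rw [h.dist_mix]
  exact le_ciInf fun z => dist_triangle _ _ _

theorem IsMetricDouble.exists_fold (h : IsMetricDouble X B D ip im) (hne : B.Nonempty) :
    ∃ r : C(D, X), (∀ x, r (ip x) = x) ∧ (∀ x, r (im x) = x) ∧
      ∀ d d', dist (r d) (r d') ≤ dist d d' := by
  have hex : ∀ d, ∃ x, d = ip x ∨ d = im x := fun d => by
    rcases h.mem_range_or d with ⟨x, rfl⟩ | ⟨x, rfl⟩
    · exact ⟨x, Or.inl rfl⟩
    · exact ⟨x, Or.inr rfl⟩
  choose r hr using hex
  have hlip : ∀ d d', dist (r d) (r d') ≤ dist d d' := by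
    intro d d'
    rcases hr d with hd | hd <;> rcases hr d' with hd' | hd'
    · rw [← h.isom_p.dist_eq, ← hd, ← hd']
    · refine (h.dist_le_dist_mix hne _ _).trans_eq ?_
      rw [← hd, ← hd']
    · rw [dist_comm, dist_comm d]
      refine (h.dist_le_dist_mix hne _ _).trans_eq ?_
      rw [← hd, ← hd']
    · rw [← h.isom_m.dist_eq, ← hd, ← hd']
  have hmix : ∀ x y, ip x = im y → x = y := fun x y hxy => dist_le_zero.1
    ((h.dist_le_dist_mix hne x y).trans_eq (by rw [hxy, dist_self]))
  refine ⟨⟨r, (LipschitzWith.of_dist_le_mul (K := 1) fun d d' => ?_).continuous⟩,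
    fun x => ?_, fun x => ?_, hlip⟩
  · simp [hlip]
  · rcases hr (ip x) with hd | hd
    · exact (h.isom_p.injective hd).symm
    · exact (hmix _ _ hd).symm
  · rcases hr (im x) with hd | hd
    · exact hmix _ _ hd.symm
    · exact (h.isom_m.injective hd).symm

theorem IsMetricDouble.relSimplyConnected_preimage [CompactSpace X]
    (h : IsMetricDouble X B D ip im) (hB : IsClosed B) {r : C(D, X)} (hrp : ∀ x, r (ip x) = x)
    (hrm : ∀ x, r (im x) = x) {U : Set X} {x : X} (hx : x ∈ U) (hxB : x ∈ B) (c : C(I × U, U))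
    (hc0 : ∀ y, c (0, y) = y) (hc1 : ∀ y, c (1, y) = ⟨x, hx⟩)
    (hcB : ∀ s, ∀ y : U, (y : X) ∈ B → (c (s, y) : X) ∈ B) :
    RelSimplyConnected (r ⁻¹' U) := by
  classical
  let q : I × (r ⁻¹' U) → X := fun p => c (p.1, ⟨r p.2, p.2.2⟩)
  have hq : Continuous q := by
    refine continuous_subtype_val.comp (c.continuous.comp (continuous_fst.prodMk ?_))
    exact Continuous.subtype_mk (by fun_prop) _
  have hrip : ∀ d ∈ range ip, ip (r d) = d := by
    rintro _ ⟨x, rfl⟩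
    rw [hrp]
  have hrim : ∀ d ∈ range im, im (r d) = d := by
    rintro _ ⟨x, rfl⟩
    rw [hrm]
  have hag : ∀ p, (p.2 : D) ∈ range ip → (p.2 : D) ∈ range im → ip (q p) = im (q p) := by
    intro p h1 h2
    refine h.agree _ (hcB _ _ ?_)
    exact (h.eq_of_ip_eq_im hB ⟨x, hxB⟩ ((hrip _ h1).trans (hrim _ h2).symm)).2
  let F : I × (r ⁻¹' U) → D := fun p => if (p.2 : D) ∈ range ip then ip (q p) else im (q p)
  have hFp : ∀ p, (p.2 : D) ∈ range ip → F p = ip (q p) := fun p hp => by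
    simp only [F]
    exact if_pos hp
  have hFm : ∀ p, (p.2 : D) ∈ range im → F p = im (q p) := fun p hp => by
    by_cases hp' : (p.2 : D) ∈ range ip
    · exact (hFp p hp').trans (hag p hp' hp)
    · simp only [F]
      exact if_neg hp'
  have hF : Continuous F := by
    have hsnd : Continuous fun p : I × (r ⁻¹' U) => (p.2 : D) := by fun_prop
    have h1 : ContinuousOn F {p | (p.2 : D) ∈ range ip} :=
      (h.isom_p.continuous.comp hq).continuousOn.congr hFp
    have h2 : ContinuousOn F {p | (p.2 : D) ∈ range im} :=
      (h.isom_m.continuous.comp hq).continuousOn.congr hFm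
    have h3 := h1.union_of_isClosed h2
      ((isCompact_range h.isom_p.continuous).isClosed.preimage hsnd)
      ((isCompact_range h.isom_m.continuous).isClosed.preimage hsnd)
    exact continuousOn_univ.1 (h3.mono fun p _ => h.mem_range_or (p.2 : D))
  refine relSimplyConnected_of_homotopic_const (y := ip x)
    ⟨⟨⟨F, hF⟩, fun d => ?_, fun d => ?_⟩⟩
  · have h0 : q (0, d) = r d := by simp [q, hc0]
    rcases h.mem_range_or (d : D) with hd | hd
    · refine (hFp (0, d) hd).trans ?_
      rw [h0]
      exact hrip _ hd
    · refine (hFm (0, d) hd).trans ?_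
      rw [h0]
      exact hrim _ hd
  · have h1 : q (1, d) = x := by simp [q, hc1]
    rcases h.mem_range_or (d : D) with hd | hd
    · refine (hFp (1, d) hd).trans ?_
      rw [h1]
      rfl
    · refine (hFm (1, d) hd).trans ?_
      rw [h1]
      exact (h.agree x hxB).symm

end Double

section Folding

variable {X Y : Type*} [TopologicalSpace X] [TopologicalSpace Y]

/-- Two curves have homotopic restrictions between two parameters. -/
def SegHomotopic (f g : C(ℝ, X)) (s t : ℝ) : Prop :=
  ∀ ⦃u v : X⦄ (hu : f s = u) (hv : f t = v) (hu' : g s = u) (hv' : g t = v),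
    segClass f s t hu hv = segClass g s t hu' hv'

theorem SegHomotopic.trans {f g : C(ℝ, X)} {r s t : ℝ} (h : SegHomotopic f g r s)
    (h' : SegHomotopic f g s t) (hs : f s = g s) : SegHomotopic f g r t := by
  intro u v hu hv hu' hv'
  rw [← segClass_trans f r s t hu rfl hv, ← segClass_trans g r s t hu' hs.symm hv',
    h hu rfl hu' hs.symm, h' rfl hv hs.symm hv']

theorem SegHomotopic.symm {f g : C(ℝ, X)} {s t : ℝ} (h : SegHomotopic f g s t) :
    SegHomotopic f g t s := by
  intro u v hu hv hu' hv'
  rw [← segClass_symm f s t hv hu, ← segClass_symm g s t hv' hu', h hv hu hv' hu']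

theorem segHomotopic_self (f g : C(ℝ, X)) (t : ℝ) : SegHomotopic f g t t := by
  intro u v hu hv hu' hv'
  obtain rfl : u = v := hu.symm.trans hv
  rw [segClass_self, segClass_self]

theorem segClass_comp_eq_of_mk_eq (φ : C(X, Y)) (k : C(ℝ, X)) (a b : ℝ) {p q : X} (hp : k a = p)
    (hq : k b = q) (β : Path p q) (h : segClass k a b hp hq = .mk β) {u v : Y}
    (hu : φ.comp k a = u) (hv : φ.comp k b = v) (hu' : φ.comp (pathExt β) 0 = u)
    (hv' : φ.comp (pathExt β) 1 = v) :
    segClass (φ.comp k) a b hu hv = segClass (φ.comp (pathExt β)) 0 1 hu' hv' := by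
  subst hp hq
  have h1 : φ (k a) = u := hu
  have h2 : φ (k b) = v := hv
  subst h1 h2
  rw [← segClass_pathExt β] at h
  exact congrArg (fun z => z.map φ) h

theorem segClass_comp_eq_refl_of_segClass_eq_refl (φ : C(X, Y)) (k : C(ℝ, X)) {a b : ℝ} {p : X}
    (hp : k a = p) (hq : k b = p) (h : segClass k a b hp hq = Path.Homotopic.Quotient.refl p)
    {u : Y} (hu : φ.comp k a = u) (hv : φ.comp k b = u) :
    segClass (φ.comp k) a b hu hv = Path.Homotopic.Quotient.refl u := by
  subst hp
  have h1 : φ (k a) = u := hu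
  subst h1
  exact congrArg (fun z => z.map φ) h

end Folding

section Dichotomy

variable {X D : Type*} [MetricSpace X] [MetricSpace D] {ip im : X → D}

theorem IsMetricDouble.segHomotopic_of_formsContractible
    (h : IsMetricDouble X (surfaceBoundary X) D ip im) (k : C(ℝ, X)) {a b : ℝ} (γ : C(I, X))
    (hγk : ∀ t : I, γ t = k (a + t * (b - a))) (hγ : IsSimpleArc γ)
    (hform : FormsContractibleJordanWithBoundary γ) :
    SegHomotopic ((⟨im, h.isom_m.continuous⟩ : C(X, D)).comp k)
      ((⟨ip, h.isom_p.continuous⟩ : C(X, D)).comp k) a b := by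
  obtain ⟨β, hβi, hβB, hβ0, hβ1, hβ⟩ := hform
  have hka : k a = γ 0 := by simp [hγk]
  have hkb : k b = γ 1 := by simp [hγk]
  let γ' : Path (γ 0) (γ 1) := ⟨γ, rfl, rfl⟩
  let β' : Path (γ 0) (γ 1) := ⟨β, hβ0, hβ1⟩
  have hmk : Path.Homotopic.Quotient.mk γ' = Path.Homotopic.Quotient.mk β' := by
    refine mk_eq_mk_of_isContractibleJordanCurve hγ.1 hβi (fun s t hst => ?_) hβ
    by_contra! hs
    refine hγ.2.2.2 s hs.1 hs.2 ?_
    have : γ s = β t := hst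
    rw [this]
    exact hβB (mem_range_self t)
  have hseg : segClass k a b hka hkb = .mk β' := by
    rw [← hmk]
    unfold segClass
    congr 1
    ext t
    exact (hγk t).symm
  have hag : ∀ t, im (pathExt β' t) = ip (pathExt β' t) := by
    intro t
    refine (h.agree _ (hβB ?_)).symm
    have : pathExt β' t ∈ range β' := by
      rw [← β'.extend_range]
      exact mem_range_self t
    exact this
  intro u v hu hv hu' hv'
  have e0 : im (pathExt β' 0) = u := by
    rw [pathExt_zero, ← hu, ← hka]
    rfl
  have e1 : im (pathExt β' 1) = v := by
    rw [pathExt_one, ← hv, ← hkb]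
    rfl
  rw [segClass_comp_eq_of_mk_eq _ k a b hka hkb β' hseg hu hv e0 e1,
    segClass_comp_eq_of_mk_eq _ k a b hka hkb β' hseg hu' hv' ((hag 0).symm.trans e0)
      ((hag 1).symm.trans e1)]
  exact segClass_congr' zero_le_one fun t _ => hag t

theorem IsMetricDouble.isSimpleArc_of_gap (h : IsMetricDouble X (surfaceBoundary X) D ip im)
    (hne : (surfaceBoundary X).Nonempty) {r : C(D, X)} {f : C(ℝ, D)}
    {a b : ℝ} (hab : a < b) (ha : f a ∈ range ip) (hb : f b ∈ range ip)
    (hgap : ∀ t ∈ Ioo a b, f t ∉ range ip) (hfim : ∀ t ∈ Icc a b, f t = im (r (f t)))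
    (hinj : InjOn f (Icc a b)) (γ : C(I, X)) (hγ : ∀ t : I, γ t = r (f (a + t * (b - a)))) :
    IsSimpleArc γ := by
  have hmem : ∀ t : I, a + t * (b - a) ∈ Icc a b := fun t =>
    ⟨by nlinarith [t.2.1], by nlinarith [t.2.2]⟩
  have hend : ∀ t ∈ Icc a b, f t ∈ range ip → r (f t) ∈ surfaceBoundary X := by
    rintro t ht ⟨x, hx⟩
    obtain ⟨h1, h2⟩ := h.eq_of_ip_eq_im isClosed_surfaceBoundary hne (hx.trans (hfim t ht))
    rwa [← h1]
  refine ⟨fun s t hst => ?_, ?_, ?_, fun t ht0 ht1 hB => ?_⟩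
  · rw [hγ, hγ] at hst
    have := hinj (hmem s) (hmem t) (by rw [hfim _ (hmem s), hfim _ (hmem t), hst])
    have h2 : (s : ℝ) * (b - a) = t * (b - a) := by linarith
    exact Subtype.ext (mul_right_cancel₀ (by linarith : b - a ≠ 0) h2)
  · rw [hγ]
    refine hend _ (hmem 0) ?_
    simpa using ha
  · rw [hγ]
    refine hend _ (hmem 1) ?_
    simpa using hb
  · have h0 : (0 : ℝ) < t := lt_of_le_of_ne t.2.1 fun h' => ht0 (Subtype.ext h'.symm)
    have h1 : (t : ℝ) < 1 := lt_of_le_of_ne t.2.2 fun h' => ht1 (Subtype.ext h')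
    refine hgap (a + t * (b - a)) ⟨by nlinarith, by nlinarith⟩ ?_
    rw [hfim _ (hmem t)]
    rw [hγ] at hB
    exact ⟨_, h.agree _ hB⟩

variable [CompactSpace X]

theorem IsMetricDouble.exists_segHomotopic_nhds (h : IsMetricDouble X (surfaceBoundary X) D ip im)
    (hX : IsSurface X) (hne : (surfaceBoundary X).Nonempty) {r : C(D, X)}
    (hrp : ∀ x, r (ip x) = x) (hrm : ∀ x, r (im x) = x) {f g : C(ℝ, D)}
    (hg : ∀ t, g t = ip (r (f t))) {t : ℝ} (ht : f t ∈ range ip) :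
    ∃ ε > 0, ∀ a b, a ≤ b → |a - t| < ε → |b - t| < ε → SegHomotopic f g a b := by
  have hB : IsClosed (surfaceBoundary X) := isClosed_surfaceBoundary
  have hex : ∃ N : Set ℝ, IsOpen N ∧ t ∈ N ∧
      ((∀ s ∈ N, f s = g s) ∨ ∃ W : Set D, RelSimplyConnected W ∧ ∀ s ∈ N, f s ∈ W ∧ g s ∈ W) := by
    by_cases him : f t ∈ range im
    · obtain ⟨x, hx⟩ := ht
      obtain ⟨y, hy⟩ := him
      obtain ⟨-, hxB⟩ := h.eq_of_ip_eq_im hB hne (hx.trans hy.symm)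
      obtain ⟨U, hxU, c, hU, h0, h1, hc⟩ := hX.exists_contraction x
      refine ⟨(fun s => r (f s)) ⁻¹' U, hU.preimage (by fun_prop), ?_, Or.inr
        ⟨_, h.relSimplyConnected_preimage hB hrp hrm hxU hxB c h0 h1 hc, fun s hs => ⟨hs, ?_⟩⟩⟩
      · rw [mem_preimage, ← hx, hrp]
        exact hxU
      · rw [mem_preimage, hg, hrp]
        exact hs
    · refine ⟨f ⁻¹' (range im)ᶜ,
        (isCompact_range h.isom_m.continuous).isClosed.isOpen_compl.preimage f.continuous, him,
        Or.inl fun s hs => ?_⟩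
      obtain ⟨x, hx⟩ := (h.mem_range_or (f s)).resolve_right hs
      rw [hg, ← hx, hrp]
  obtain ⟨N, hN, htN, hcase⟩ := hex
  obtain ⟨ε, hε, hball⟩ := Metric.isOpen_iff.1 hN t htN
  refine ⟨ε, hε, fun a b hab ha hb u v hu hv hu' hv' => ?_⟩
  have hmem : ∀ s ∈ Icc a b, s ∈ N := by
    intro s hs
    apply hball
    rw [mem_ball, Real.dist_eq, abs_lt]
    rw [abs_lt] at ha hb
    constructor <;> linarith [hs.1, hs.2]
  rcases hcase with heq | ⟨W, hW, hfg⟩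
  · exact segClass_congr' hab fun s hs => heq s (hmem s hs)
  · exact hW.segClass_eq hab hab (fun s hs => (hfg s (hmem s hs)).1)
      fun s hs => (hfg s (hmem s hs)).2

/-- A short non-contractible Jordan curve in the double yields a short arc or a short essential
loop in the surface. -/
theorem IsMetricDouble.exists_arc_or_loop (h : IsMetricDouble X (surfaceBoundary X) D ip im)
    (hX : IsSurface X) (hne : (surfaceBoundary X).Nonempty) {J : Set D}
    (hJ : IsNonContractibleJordanCurve J) :
    (∃ γ : C(I, X), IsSimpleArc γ ∧ ¬ FormsContractibleJordanWithBoundary γ ∧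
      diam (range γ) ≤ diam J) ∨
    ∃ (f : C(ℝ, X)) (u : X) (hu : f 0 = u) (hu' : f 1 = u),
      (∀ s ∈ Icc (0 : ℝ) 1, ∀ t ∈ Icc (0 : ℝ) 1, dist (f s) (f t) ≤ diam J) ∧
      segClass f 0 1 hu hu' ≠ Path.Homotopic.Quotient.refl u := by
  obtain ⟨⟨ψ⟩, hJn⟩ := hJ
  let f₀ : C(Circle1, D) := ⟨fun w => (ψ.symm w : D), by fun_prop⟩
  have hf₀ : Function.Injective f₀ := Subtype.val_injective.comp ψ.symm.injective
  have hJr : range f₀ = J := by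
    change range (Subtype.val ∘ ψ.symm) = J
    rw [ψ.symm.surjective.range_comp, Subtype.range_coe]
  have hnull := hJn f₀ hf₀ hJr
  have hJb : Bornology.IsBounded J := by
    rw [← hJr]
    exact (isCompact_range f₀.continuous).isBounded
  obtain ⟨r, hrp, hrm, hr⟩ := h.exists_fold hne
  let ipc : C(X, D) := ⟨ip, h.isom_p.continuous⟩
  let imc : C(X, D) := ⟨im, h.isom_m.continuous⟩
  have hpc : IsClosed (range ip) := (isCompact_range h.isom_p.continuous).isClosed
  have hmc : IsClosed (range im) := (isCompact_range h.isom_m.continuous).isClosed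
  have hd : ∀ (e : C(ℝ, Circle1)) s t, dist (r (f₀ (e s))) (r (f₀ (e t))) ≤ diam J := by
    intro e s t
    refine (hr _ _).trans (dist_le_diam_of_mem hJb ?_ ?_) <;> rw [← hJr] <;> exact mem_range_self _
  have hloop : ∀ (e : C(ℝ, Circle1)) (he : IsCircleParam e) (φ : C(X, D)),
      SegHomotopic (f₀.comp e) (φ.comp (r.comp (f₀.comp e))) 0 1 →
      φ (r (f₀ (e 0))) = f₀ (e 0) →
      ∃ (f : C(ℝ, X)) (u : X) (hu : f 0 = u) (hu' : f 1 = u),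
        (∀ s ∈ Icc (0 : ℝ) 1, ∀ t ∈ Icc (0 : ℝ) 1, dist (f s) (f t) ≤ diam J) ∧
        segClass f 0 1 hu hu' ≠ Path.Homotopic.Quotient.refl u := by
    intro e he φ hseg hφ
    have hcl : r.comp (f₀.comp e) 1 = r (f₀ (e 0)) := by
      simp [he.closed]
    have hcl' : f₀.comp e 1 = f₀ (e 0) := by simp [he.closed]
    refine ⟨r.comp (f₀.comp e), r (f₀ (e 0)), rfl, hcl, fun s _ t _ => hd e s t, fun hcon => ?_⟩
    refine hnull (isNullhomotopic_of_segClass_eq_refl he f₀ rfl hcl' ?_)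
    have h1 : φ.comp (r.comp (f₀.comp e)) 1 = f₀ (e 0) := (congrArg φ hcl).trans hφ
    rw [hseg rfl hcl' hφ h1]
    exact segClass_comp_eq_refl_of_segClass_eq_refl φ _ rfl hcl hcon hφ h1
  by_cases hall : ∀ z, f₀ z ∈ range im
  · right
    have hz : (EuclideanSpace.single 0 1 : EuclideanSpace ℝ (Fin 2)) ∈ Circle1 := by
      simp [Circle1]
    obtain ⟨e, he, -⟩ := exists_isCircleParam ⟨_, hz⟩
    have hfix : ∀ t, f₀ (e t) = im (r (f₀ (e t))) := by
      intro t
      obtain ⟨x, hx⟩ := hall (e t)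
      rw [← hx, hrm]
    exact hloop e he imc (fun u v hu hv hu' hv' =>
      segClass_congr' zero_le_one fun t _ => hfix t) (hfix 0).symm
  · push Not at hall
    obtain ⟨z, hz⟩ := hall
    obtain ⟨e, he, rfl⟩ := exists_isCircleParam z
    let f : C(ℝ, D) := f₀.comp e
    let g : C(ℝ, D) := ipc.comp (r.comp f)
    have hfix : ∀ t, f t ∈ range ip → f t = g t := by
      rintro t ⟨x, hx⟩
      change f t = ip (r (f t))
      rw [← hx, hrp]
    have hf0 : f 0 ∈ range ip := (h.mem_range_or _).resolve_right hz
    have hf10 : f 1 = f 0 := congrArg f₀ he.closed.symm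
    have hfinj : InjOn f (Ico 0 1) := fun s hs t ht hst => he.injOn hs ht (hf₀ hst)
    by_cases hgap : ∀ a ∈ Icc (0 : ℝ) 1, ∀ b ∈ Icc (0 : ℝ) 1, f a ∈ range ip → f b ∈ range ip →
        a < b → (∀ t ∈ Ioo a b, f t ∉ range ip) → SegHomotopic f g a b
    · right
      refine hloop e he ipc ?_ (hfix 0 hf0).symm
      refine gap_induction (C := Icc 0 1 ∩ f ⁻¹' range ip)
        (isClosed_Icc.inter (hpc.preimage f.continuous)) inter_subset_left ⟨by simp, hf0⟩
        ⟨by simp, by rwa [mem_preimage, hf10]⟩ (segHomotopic_self f g 0)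
        (fun t ht u h1 h2 => h1.trans h2 (hfix t ht.2)) ?_ ?_
      · intro t ht
        obtain ⟨ε, hε, hloc⟩ := h.exists_segHomotopic_nhds hX hne hrp hrm (f := f) (g := g)
          (fun _ => rfl) ht.2
        refine ⟨ε, hε, fun s _ hst => ?_⟩
        have htt : |t - t| < ε := by simpa using hε
        rcases le_total s t with hle | hle
        · exact ⟨hloc s t hle hst htt, (hloc s t hle hst htt).symm⟩
        · exact ⟨(hloc t s hle htt hst).symm, hloc t s hle htt hst⟩
      · intro a ha b hb hab hg
        refine hgap a ha.1 b hb.1 ha.2 hb.2 hab fun t ht htp => hg t ht ⟨⟨?_, ?_⟩, htp⟩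
        · exact ha.1.1.trans ht.1.le
        · exact ht.2.le.trans hb.1.2
    · left
      push Not at hgap
      obtain ⟨a, ha, b, hb, hap, hbp, hab, hg, hns⟩ := hgap
      have hIoo : ∀ t ∈ Ioo a b, f t ∈ range im := fun t ht =>
        (h.mem_range_or _).resolve_left (hg t ht)
      have hIcc : ∀ t ∈ Icc a b, f t ∈ range im := by
        intro t ht
        rw [← closure_Ioo hab.ne] at ht
        exact closure_minimal hIoo (hmc.preimage f.continuous) ht
      have hfim : ∀ t ∈ Icc a b, f t = im (r (f t)) := by
        intro t ht
        obtain ⟨x, hx⟩ := hIcc t ht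
        rw [← hx, hrm]
      have hb1 : b < 1 := by
        refine lt_of_le_of_ne hb.2 ?_
        rintro rfl
        exact hz (hf10 ▸ hIcc 1 (right_mem_Icc.2 hab.le))
      have hinj : InjOn f (Icc a b) :=
        hfinj.mono fun t (ht : t ∈ Icc a b) => mem_Ico.2 ⟨ha.1.trans ht.1, ht.2.trans_lt hb1⟩
      let γ : C(I, X) := ⟨fun t => r (f (a + t * (b - a))), by fun_prop⟩
      have hγ := h.isSimpleArc_of_gap hne hab hap hbp hg hfim hinj γ fun _ => rfl
      refine ⟨γ, hγ, fun hform => hns ?_, ?_⟩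
      · have hseg := h.segHomotopic_of_formsContractible (r.comp f) (a := a) (b := b) γ
          (fun _ => rfl) hγ hform
        intro u v hu hv hu' hv'
        have h1 : imc.comp (r.comp f) a = u := (hfim a (left_mem_Icc.2 hab.le)).symm.trans hu
        have h2 : imc.comp (r.comp f) b = v := (hfim b (right_mem_Icc.2 hab.le)).symm.trans hv
        rw [← hseg h1 h2 hu' hv']
        exact segClass_congr' hab.le fun t ht => hfim t ht
      · refine diam_le_of_forall_dist_le diam_nonneg ?_
        rintro _ ⟨s, rfl⟩ _ ⟨t, rfl⟩
        exact hd e _ _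

end Dichotomy

section EssentialLoops

variable {X : Type*}

theorem segClass_comp_ne_refl_of_homotopic_id [TopologicalSpace X] {k : C(X, X)}
    (hk : k.Homotopic (.id X)) {f : C(ℝ, X)} {a b : ℝ} {v : X} (h0 : f a = v) (h1 : f b = v)
    (hf : segClass f a b h0 h1 ≠ Path.Homotopic.Quotient.refl v)
    (h0' : k.comp f a = k v) (h1' : k.comp f b = k v) :
    segClass (k.comp f) a b h0' h1' ≠ Path.Homotopic.Quotient.refl (k v) := by
  obtain ⟨F⟩ := hk
  intro hcon
  apply hf
  have key : Path.Homotopic.Quotient.trans (segClass (k.comp f) a b h0' h1')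
      (.mk (F.evalAt v)) =
      Path.Homotopic.Quotient.trans (.mk (F.evalAt v)) (segClass f a b h0 h1) :=
    Path.Homotopic.Quotient.eq.2 (Path.Homotopic.map_trans_evalAt F (segPath f a b h0 h1))
  rw [hcon, Path.Homotopic.Quotient.refl_trans] at key
  refine pclass_trans_left_cancel (τ := .mk (F.evalAt v)) (key.symm.trans ?_)
  exact (Path.Homotopic.Quotient.trans_refl _).symm

/-- A short essential loop in a compact length surface yields a short non-contractible Jordan curve
in the interior of the surface. -/
theorem IsSurface.exists_isNonContractibleJordanCurve [MetricSpace X] [CompactSpace X]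
    (hX : IsSurface X) (hlen : IsLengthSpace X) {f : C(ℝ, X)} {u : X} (hu : f 0 = u)
    (hu' : f 1 = u) {ε : ℝ} (hε : 0 < ε)
    (hd : ∀ s ∈ Icc (0 : ℝ) 1, ∀ t ∈ Icc (0 : ℝ) 1, dist (f s) (f t) ≤ ε)
    (hf : segClass f 0 1 hu hu' ≠ Path.Homotopic.Quotient.refl u) :
    ∃ J : Set X, IsNonContractibleJordanCurve J ∧ Disjoint J (surfaceBoundary X) ∧
      diam J ≤ 5 * ε := by
  obtain ⟨δ, hδ0, hδ⟩ := hX.exists_uniform_relSimplyConnected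
  obtain ⟨_, κ, L, hL, hκL, hκ⟩ := exists_short_essential_loop hlen hδ0 hδ hu hu' hd hf
  obtain ⟨g, v, h0, h1, hgd, hginj, hg⟩ := exists_simple_essential_loop hlen hδ0 hδ hκL hκ
  obtain ⟨k, hkinj, hkid, hkd, hkB⟩ := hX.exists_push hε
  have h0' : k.comp g 0 = k v := congrArg k h0
  have h1' : k.comp g 1 = k v := congrArg k h1
  refine ⟨k.comp g '' Icc 0 1, isNonContractibleJordanCurve_image h0' h1'
    (fun s hs t ht hst => hginj hs ht (hkinj hst))
    (segClass_comp_ne_refl_of_homotopic_id hkid h0 h1 hg h0' h1'), ?_, ?_⟩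
  · rw [Set.disjoint_left]
    rintro _ ⟨t, -, rfl⟩
    exact hkB _
  · refine diam_le_of_forall_dist_le (by positivity) ?_
    rintro _ ⟨s, hs, rfl⟩ _ ⟨t, ht, rfl⟩
    have e1 := hkd (g s)
    have e2 := hkd (g t)
    rw [dist_comm] at e2
    have e3 := dist_triangle4 (k (g s)) (g s) (g t) (k (g t))
    have e4 := hgd s hs t ht
    change dist (k (g s)) (k (g t)) ≤ 5 * ε
    linarith

theorem IsJordanCurve.diam_pos [MetricSpace X] {J : Set X} (hJ : IsJordanCurve J) :
    0 < diam J := by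
  obtain ⟨ψ⟩ := hJ
  have hc : CompactSpace Circle1 := isCompact_iff_compactSpace.1 (isCompact_sphere 0 1)
  have hJc : IsCompact J := isCompact_iff_compactSpace.2 ψ.symm.compactSpace
  let e : EuclideanSpace ℝ (Fin 2) := EuclideanSpace.single 0 1
  have he : e ∈ Circle1 := by simp [e, Circle1]
  have he' : -e ∈ Circle1 := by simp [e, Circle1]
  have hne : (⟨e, he⟩ : Circle1) ≠ ⟨-e, he'⟩ := by
    intro h
    have h2 := congrArg (fun z : EuclideanSpace ℝ (Fin 2) => z 0) (congrArg Subtype.val h)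
    norm_num [e] at h2
  have hne' : ((ψ.symm ⟨e, he⟩ : J) : X) ≠ ψ.symm ⟨-e, he'⟩ := fun h =>
    hne (ψ.symm.injective (Subtype.ext h))
  exact (dist_pos.2 hne').trans_le (dist_le_diam_of_mem hJc.isBounded (Subtype.coe_prop _)
    (Subtype.coe_prop _))

end EssentialLoops

theorem exists_strictMono_tendsto_zero_of_iInf_le_zero {d : ℕ → ℝ} (hd : ∀ n, 0 < d n)
    (hinf : ⨅ n, d n ≤ 0) : ∃ φ : ℕ → ℕ, StrictMono φ ∧ Tendsto (d ∘ φ) atTop (𝓝 0) := by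
  have hfreq : ∀ k : ℕ, ∃ᶠ n in atTop, d n < 1 / ((k : ℝ) + 1) := by
    intro k
    rw [frequently_atTop]
    intro N
    by_contra! hN
    have hlow : ∀ M : ℕ, ∃ ε > 0, ∀ n < M, ε ≤ d n := by
      intro M
      induction M with
      | zero => exact ⟨1, one_pos, fun n hn => absurd hn (by omega)⟩
      | succ M ih =>
        obtain ⟨ε, hε, h⟩ := ih
        refine ⟨min ε (d M), lt_min hε (hd M), fun n hn => ?_⟩
        rcases Nat.lt_succ_iff_lt_or_eq.1 hn with hn | rfl
        · exact (min_le_left _ _).trans (h n hn)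
        · exact min_le_right _ _
    obtain ⟨ε, hε, h⟩ := hlow N
    have : min ε (1 / ((k : ℝ) + 1)) ≤ ⨅ n, d n := le_ciInf fun n => by
      rcases lt_or_ge n N with hn | hn
      · exact (min_le_left _ _).trans (h n hn)
      · exact (min_le_right _ _).trans (hN n hn)
    have h2 : 0 < min ε (1 / ((k : ℝ) + 1)) := lt_min hε (by positivity)
    linarith
  obtain ⟨φ, hφ, h⟩ := extraction_forall_of_frequently hfreq
  exact ⟨φ, hφ, squeeze_zero (fun n => (hd _).le) (fun n => (h n).le)
    tendsto_one_div_add_atTop_nhds_zero_nat⟩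

/-- If the alternatives `P`, `Q`, `R` together occur along a sequence, one of them occurs along a
subsequence. -/
theorem exists_strictMono_forall_or_or {P Q R : ℕ → Prop} (h : ∀ n, P n ∨ Q n ∨ R n) :
    ∃ φ : ℕ → ℕ, StrictMono φ ∧ ((∀ n, P (φ n)) ∨ (∀ n, Q (φ n)) ∨ ∀ n, R (φ n)) := by
  have hf : ∃ᶠ n in atTop, P n ∨ Q n ∨ R n := Frequently.of_forall h
  rw [frequently_or_distrib, frequently_or_distrib] at hf
  rcases hf with hf | hf | hf <;> obtain ⟨φ, hφ, hall⟩ := extraction_of_frequently_atTop hf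
  · exact ⟨φ, hφ, Or.inl hall⟩
  · exact ⟨φ, hφ, Or.inr (Or.inl hall)⟩
  · exact ⟨φ, hφ, Or.inr (Or.inr hall)⟩

/-! ## STATEMENT 13 -/

theorem stmt13 (c : ℤ) (b : ℕ) (hb : 0 < b)
    (Xs : ℕ → Type) [∀ n, MetricSpace (Xs n)]
    (hsurf : ∀ n, IsCompactSurface (Xs n)) (hlen : ∀ n, IsLengthSpace (Xs n))
    (hnb : ∀ n, (surfaceBoundaryComponents (Xs n)).ncard = b)
    (hrc : ∀ n, redConnNum (Xs n) = c)
    (D : ℕ → Type) [∀ n, MetricSpace (D n)]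
    (ip im : ∀ n, Xs n → D n)
    (hdouble : ∀ n, IsMetricDouble (Xs n) (surfaceBoundary (Xs n)) (D n) (ip n) (im n))
    (hirr : ¬ RegularDoubleSeq D) :
    ∃ φ : ℕ → ℕ, StrictMono φ ∧
      ((∃ γ : ∀ n, C(I, Xs (φ n)),
          (∀ n, IsSimpleArc (γ n)) ∧
          (∀ n, ¬ SeparatesSpace (Set.range (γ n))) ∧
          Filter.Tendsto (fun n => Metric.diam (Set.range (γ n))) Filter.atTop (nhds 0)) ∨
       (∃ γ : ∀ n, C(I, Xs (φ n)),
          (∀ n, IsSimpleArc (γ n)) ∧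
          (∀ n, SeparatesSpace (Set.range (γ n))) ∧
          (∀ n, ¬ FormsContractibleJordanWithBoundary (γ n)) ∧
          Filter.Tendsto (fun n => Metric.diam (Set.range (γ n))) Filter.atTop (nhds 0)) ∨
       (∃ J : ∀ n, Set (Xs (φ n)),
          (∀ n, IsNonContractibleJordanCurve (J n)) ∧
          (∀ n, (J n ∩ surfaceBoundary (Xs (φ n))).Subsingleton) ∧
          Filter.Tendsto (fun n => Metric.diam (J n)) Filter.atTop (nhds 0))) := by
  have hne : ∀ n, (surfaceBoundary (Xs n)).Nonempty := by
    intro n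
    obtain ⟨_, x, hx, -⟩ := nonempty_of_ncard_ne_zero ((hnb n).trans_ne hb.ne')
    exact ⟨x, hx⟩
  unfold RegularDoubleSeq at hirr
  push Not at hirr
  obtain ⟨J, hJ, hinf⟩ := hirr
  have hpos : ∀ n, 0 < diam (J n) := fun n => (hJ n).1.diam_pos
  obtain ⟨φ, hφ, hlim⟩ := exists_strictMono_tendsto_zero_of_iInf_le_zero hpos hinf
  have hlim5 : Tendsto (fun n => 5 * diam (J (φ n))) atTop (𝓝 0) := by
    simpa using hlim.const_mul 5
  have halt : ∀ n,
      (∃ γ : C(I, Xs (φ n)), IsSimpleArc γ ∧ ¬ SeparatesSpace (range γ) ∧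
        diam (range γ) ≤ 5 * diam (J (φ n))) ∨
      (∃ γ : C(I, Xs (φ n)), IsSimpleArc γ ∧ SeparatesSpace (range γ) ∧
        ¬ FormsContractibleJordanWithBoundary γ ∧ diam (range γ) ≤ 5 * diam (J (φ n))) ∨
      (∃ K : Set (Xs (φ n)), IsNonContractibleJordanCurve K ∧
        (K ∩ surfaceBoundary (Xs (φ n))).Subsingleton ∧ diam K ≤ 5 * diam (J (φ n))) := by
    intro n
    obtain ⟨hcomp, -, -, hX⟩ := hsurf (φ n)
    have h5 : diam (J (φ n)) ≤ 5 * diam (J (φ n)) := by linarith [hpos (φ n)]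
    rcases (hdouble (φ n)).exists_arc_or_loop hX (hne _) (hJ (φ n)) with
      ⟨γ, hγ, hform, hdiam⟩ | ⟨f, u, hu, hu', hd, hf⟩
    · by_cases hsep : SeparatesSpace (range γ)
      · exact Or.inr (Or.inl ⟨γ, hγ, hsep, hform, hdiam.trans h5⟩)
      · exact Or.inl ⟨γ, hγ, hsep, hdiam.trans h5⟩
    · obtain ⟨K, hK, hKB, hKd⟩ :=
        hX.exists_isNonContractibleJordanCurve (hlen _) hu hu' (hpos _) hd hf
      refine Or.inr (Or.inr ⟨K, hK, ?_, hKd⟩)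
      rw [hKB.inter_eq]
      exact subsingleton_empty
  obtain ⟨θ, hθ, hcase⟩ := exists_strictMono_forall_or_or halt
  have hlim' := hlim5.comp hθ.tendsto_atTop
  refine ⟨φ ∘ θ, hφ.comp hθ, ?_⟩
  rcases hcase with h | h | h
  · choose γ h1 h2 h3 using h
    exact Or.inl ⟨γ, h1, h2, squeeze_zero (fun _ => diam_nonneg) h3 hlim'⟩
  · choose γ h1 h2 h3 h4 using h
    exact Or.inr (Or.inl ⟨γ, h1, h2, h3, squeeze_zero (fun _ => diam_nonneg) h4 hlim'⟩)
  · choose K h1 h2 h3 using h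
    exact Or.inr (Or.inr ⟨K, h1, h2, squeeze_zero (fun _ => diam_nonneg) h3 hlim'⟩)
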